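/- Let R be a commutative Noetherian ring and 𝔞 an ideal of R with dim R/𝔞 = 1 (the Krull dimension of the ring R/𝔞 equals 1). Let M be a finitely generated R-module and r an integer. Then the following conditions are equivalent: (i) Supp_R(H^i_𝔞(M)) consists only of maximal ideals of R for each i > r; (ii) H^i_𝔞(M) is an Artinian R-module for each i > r; (iii) H^i_𝔞(M) is an Artinian 𝔞-cofinite R-module for each i > r. -/

import Mathlib

universe u

open CategoryTheory

/-- The `i`-th Ext module `Ext^i_R(N, M)`. -/
noncomputable def extModule (R : Type u) [CommRing R] (N M : Type u)
    [AddCommGroup N] [Module R N] [AddCommGroup M] [Module R M] (i : ℕ) :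
    ModuleCat.{u} R :=
  ((Ext R (ModuleCat.{u} R) i).obj (Opposite.op (ModuleCat.of R N))).obj (ModuleCat.of R M)

/-- The `i`-th local cohomology module `H^i_𝔞(M)`. -/
noncomputable def localCohomologyModule (R : Type u) [CommRing R] (𝔞 : Ideal R)
    (M : Type u) [AddCommGroup M] [Module R M] (i : ℕ) : ModuleCat.{u} R :=
  (localCohomology 𝔞 i).obj (ModuleCat.of R M)

/-- An `R`-module `M` is `𝔞`-cofinite if `Supp M ⊆ V(𝔞)` and all the modules
`Ext^i_R(R/𝔞, M)` are finitely generated. -/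
def IsCofinite (R : Type u) [CommRing R] (𝔞 : Ideal R)
    (M : Type u) [AddCommGroup M] [Module R M] : Prop :=
  Module.support R M ⊆ PrimeSpectrum.zeroLocus (𝔞 : Set R) ∧
    ∀ i : ℕ, Module.Finite R (extModule R (R ⧸ 𝔞) M i)

/-- An `R`-module `M` is `FD_{<n}` if it has a finitely generated submodule `N` such that
the (Krull) dimension of the support of `M/N` is `< n`. -/
def IsFDLT (R : Type u) [CommRing R] (n : ℕ)
    (M : Type u) [AddCommGroup M] [Module R M] : Prop :=
  ∃ N : Submodule R M, N.FG ∧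
    Order.krullDim (Module.support R (M ⧸ N)) < ((n : ℕ∞) : WithBot ℕ∞)

section ArtinianModules

open Pointwise

variable {A : Type*} [CommRing A]

/-- Every element of `N` is annihilated by some power of the ideal `𝔞`. -/
def IsPowTorsion (𝔞 : Ideal A) (N : Type*) [AddCommGroup N] [Module A N] : Prop :=
  ∀ m : N, ∃ n : ℕ, ∀ r ∈ 𝔞 ^ n, r • m = 0

variable {N : Type*} [AddCommGroup N] [Module A N]

lemma exists_stable_of_antitone_of_le {P : Submodule A N} [IsArtinian A P]
    {f : ℕ → Submodule A N} (hf : Antitone f) (hP : ∀ n, f n ≤ P) :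
    ∃ n, ∀ m, n ≤ m → f m = f n := by
  obtain ⟨n, hn⟩ := IsArtinian.monotone_stabilizes (R := A) (M := P)
    ⟨fun i => OrderDual.toDual ((f i).comap P.subtype), fun i j h =>
      Submodule.comap_mono (hf h)⟩
  refine ⟨n, fun m hm => ?_⟩
  have h : (f n).comap P.subtype = (f m).comap P.subtype := hn m hm
  have key := congrArg (Submodule.map P.subtype) h
  rwa [Submodule.map_comap_eq_of_le (by simpa using hP n),
    Submodule.map_comap_eq_of_le (by simpa using hP m), eq_comm] at key

/-- The elements of the socle `0 :_N x` divisible in `U` by `x ^ n`. -/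
def divisibleTorsion (x : A) (n : ℕ) (U : Submodule A N) : Submodule A N :=
  (U ⊓ LinearMap.ker (LinearMap.lsmul A N (x ^ (n + 1)))).map (LinearMap.lsmul A N (x ^ n))

lemma mem_divisibleTorsion {x : A} {n : ℕ} {U : Submodule A N} {y : N} :
    y ∈ divisibleTorsion x n U ↔ ∃ u ∈ U, x ^ (n + 1) • u = 0 ∧ x ^ n • u = y := by
  simp [divisibleTorsion, and_assoc]

lemma divisibleTorsion_mono {x : A} {n : ℕ} {U V : Submodule A N} (h : U ≤ V) :
    divisibleTorsion x n U ≤ divisibleTorsion x n V :=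
  Submodule.map_mono (inf_le_inf_right _ h)

lemma divisibleTorsion_antitone (x : A) (U : Submodule A N) :
    Antitone fun n => divisibleTorsion x n U := by
  refine antitone_nat_of_succ_le fun n y hy => ?_
  obtain ⟨u, hu, h0, rfl⟩ := mem_divisibleTorsion.1 hy
  refine mem_divisibleTorsion.2 ⟨x • u, U.smul_mem x hu, ?_, ?_⟩
  · rw [smul_smul, ← pow_succ, h0]
  · rw [smul_smul, ← pow_succ]

lemma divisibleTorsion_le (x : A) (n : ℕ) (U : Submodule A N) :
    divisibleTorsion x n U ≤ Submodule.torsionBy A N x := by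
  intro y hy
  obtain ⟨u, hu, h0, rfl⟩ := mem_divisibleTorsion.1 hy
  rw [Submodule.mem_torsionBy_iff, smul_smul, ← pow_succ', h0]

lemma eq_of_divisibleTorsion_eq {x : A} (htors : ∀ m : N, ∃ n : ℕ, x ^ n • m = 0)
    {U V : Submodule A N} (hUV : U ≤ V)
    (h : ∀ n, divisibleTorsion x n V ≤ divisibleTorsion x n U) : V = U := by
  refine le_antisymm (fun v hv => ?_) hUV
  obtain ⟨n, hn⟩ := htors v
  induction n generalizing v with
  | zero => simp_all
  | succ n ih =>
    obtain ⟨u, hu, h0, hxu⟩ := mem_divisibleTorsion.1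
      (h n (mem_divisibleTorsion.2 ⟨v, hv, hn, rfl⟩))
    have := ih (v - u) (V.sub_mem hv (hUV hu)) (by rw [smul_sub, hxu, sub_self])
    simpa using U.add_mem this hu

lemma isArtinian_of_isArtinian_torsionBy {x : A} (htors : ∀ m : N, ∃ n : ℕ, x ^ n • m = 0)
    [IsArtinian A (Submodule.torsionBy A N x)] : IsArtinian A N := by
  rw [← monotone_stabilizes_iff_artinian]
  intro f
  let U : ℕ → Submodule A N := fun i => OrderDual.ofDual (f i)
  have hU : Antitone U := fun i j h => f.monotone h
  obtain ⟨k, hk⟩ := exists_stable_of_antitone_of_le (P := Submodule.torsionBy A N x)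
    (f := fun n => divisibleTorsion x n (U n))
    (fun i j h => (divisibleTorsion_antitone x _ h).trans (divisibleTorsion_mono (hU h)))
    (fun n => divisibleTorsion_le _ _ _)
  have hcol : ∀ n, ∃ i, ∀ j, i ≤ j → divisibleTorsion x n (U j) = divisibleTorsion x n (U i) :=
    fun n => exists_stable_of_antitone_of_le (P := Submodule.torsionBy A N x)
      (fun i j h => divisibleTorsion_mono (hU h)) (fun j => divisibleTorsion_le _ _ _)
  choose c hc using hcol
  let K := max k ((Finset.range k).sup c)
  refine ⟨K, fun m hm => ?_⟩
  refine (eq_of_divisibleTorsion_eq htors (hU hm) fun n => ?_ : U K = U m)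
  rcases lt_or_ge n k with hn | hn
  · have h1 : c n ≤ K := (Finset.le_sup (f := c) (Finset.mem_range.2 hn)).trans (le_max_right _ _)
    rw [hc n K h1, hc n m (h1.trans hm)]
  · have hkK : k ≤ K := le_max_left _ _
    calc divisibleTorsion x n (U K) ≤ divisibleTorsion x k (U k) :=
          (divisibleTorsion_antitone x _ hn).trans (divisibleTorsion_mono (hU hkK))
      _ = divisibleTorsion x (max n m) (U (max n m)) :=
          (hk _ (hn.trans (le_max_left _ _))).symm
      _ ≤ divisibleTorsion x n (U m) :=
          (divisibleTorsion_antitone x _ (le_max_left _ _)).trans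
            (divisibleTorsion_mono (hU (le_max_right _ _)))

lemma isArtinian_of_isArtinian_torsionBySet_finset {A : Type*} [CommRing A] (s : Finset A)
    {N : Type*} [AddCommGroup N] [Module A N]
    (htors : ∀ x ∈ s, ∀ m : N, ∃ n : ℕ, x ^ n • m = 0)
    (hart : IsArtinian A (Submodule.torsionBySet A N (s : Set A))) : IsArtinian A N := by
  classical
  induction s using Finset.induction_on generalizing N with
  | empty =>
    have : Submodule.torsionBySet A N ((∅ : Finset A) : Set A) = ⊤ := by
      ext; simp [Submodule.mem_torsionBySet_iff]
    rw [this] at hart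
    exact isArtinian_of_linearEquiv (Submodule.topEquiv (R := A) (M := N))
  | insert x s hx ih =>
    have : IsArtinian A (Submodule.torsionBy A N x) := by
      refine ih (fun y hy m => ?_) ?_
      · obtain ⟨n, hn⟩ := htors y (Finset.mem_insert_of_mem hy) m
        exact ⟨n, Subtype.ext hn⟩
      · let g : Submodule.torsionBySet A (Submodule.torsionBy A N x) (s : Set A) →ₗ[A]
            Submodule.torsionBySet A N ((insert x s : Finset A) : Set A) :=
          ((Submodule.torsionBy A N x).subtype ∘ₗ Submodule.subtype _).codRestrict _ (by
            intro m
            rw [Submodule.mem_torsionBySet_iff]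
            rintro ⟨y, hy⟩
            rcases Finset.mem_insert.1 (Finset.mem_coe.1 hy) with rfl | hy
            · exact (Submodule.mem_torsionBy_iff _ _).1 m.1.2
            · exact congrArg Subtype.val ((Submodule.mem_torsionBySet_iff _ _).1 m.2 ⟨y, hy⟩))
        refine isArtinian_of_injective g fun a b hab => ?_
        have h := congrArg Subtype.val hab
        exact Subtype.ext (Subtype.ext h)
    exact isArtinian_of_isArtinian_torsionBy (htors x (Finset.mem_insert_self _ _))

/-- Melkersson's criterion. -/
theorem IsPowTorsion.isArtinian [IsNoetherianRing A] {𝔞 : Ideal A} (h : IsPowTorsion 𝔞 N)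
    (hart : IsArtinian A (Submodule.torsionBySet A N (𝔞 : Set A))) : IsArtinian A N := by
  obtain ⟨s, rfl⟩ := IsNoetherian.noetherian 𝔞
  refine isArtinian_of_isArtinian_torsionBySet_finset s (fun x hx m => ?_) ?_
  · obtain ⟨n, hn⟩ := h m
    exact ⟨n, hn _ (Ideal.pow_mem_pow (Ideal.subset_span hx) n)⟩
  · rwa [Submodule.torsionBySet_eq_torsionBySet_span]

lemma mem_torsionBySet_ideal {𝔞 : Ideal A} {m : N} :
    m ∈ Submodule.torsionBySet A N (𝔞 : Set A) ↔ ∀ r ∈ 𝔞, r • m = 0 := by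
  simp [Submodule.mem_torsionBySet_iff]

theorem finite_of_pow_smul_eq_zero {A : Type*} [CommRing A] [IsNoetherianRing A]
    {𝔞 : Ideal A} (n : ℕ) {N : Type*} [AddCommGroup N] [Module A N]
    (h : ∀ r ∈ 𝔞 ^ n, ∀ m : N, r • m = 0)
    (hfin : Module.Finite A (Submodule.torsionBySet A N (𝔞 : Set A))) : Module.Finite A N := by
  induction n generalizing N with
  | zero =>
    have : Subsingleton N := subsingleton_of_forall_eq 0 fun m => by
      simpa using h 1 (by simp) m
    infer_instance
  | succ n ih =>
    let N₁ := Submodule.torsionBySet A N ((𝔞 ^ n : Ideal A) : Set A)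
    have hN₁ : Module.Finite A N₁ := by
      refine ih (fun r hr m => Subtype.ext (mem_torsionBySet_ideal.1 m.2 r hr)) ?_
      let g : Submodule.torsionBySet A N₁ (𝔞 : Set A) →ₗ[A]
          Submodule.torsionBySet A N (𝔞 : Set A) :=
        (N₁.subtype ∘ₗ Submodule.subtype _).codRestrict _ fun m =>
          mem_torsionBySet_ideal.2 fun r hr =>
            congrArg Subtype.val (mem_torsionBySet_ideal.1 m.2 r hr)
      exact Module.Finite.of_injective g fun a b hab => by
        have h := congrArg Subtype.val hab
        exact Subtype.ext (Subtype.ext h)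
    obtain ⟨s, hs⟩ := IsNoetherian.noetherian 𝔞
    let φ : N →ₗ[A] (s → N₁) := LinearMap.pi fun x =>
      (LinearMap.lsmul A N x.1).codRestrict N₁ fun m => mem_torsionBySet_ideal.2 fun r hr => by
        rw [LinearMap.lsmul_apply, smul_smul]
        exact h _ (by rw [pow_succ]; exact Ideal.mul_mem_mul hr (hs ▸ Ideal.subset_span x.2)) m
    have hker : LinearMap.ker φ = Submodule.torsionBySet A N (𝔞 : Set A) := by
      ext m
      rw [← hs, ← Submodule.torsionBySet_eq_torsionBySet_span, Submodule.mem_torsionBySet_iff,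
        LinearMap.mem_ker, funext_iff]
      exact forall_congr' fun x => Subtype.ext_iff
    have : Module.Finite A (LinearMap.ker φ) := by rw [hker]; exact hfin
    exact Module.Finite.of_exact (f := (LinearMap.ker φ).subtype) (g := φ.rangeRestrict)
      (by rw [LinearMap.exact_iff, LinearMap.ker_rangeRestrict, Submodule.range_subtype])
      φ.surjective_rangeRestrict

/-- A nonzero submodule on which every scalar acts surjectively or nilpotently. -/
def IsSecondary (V : Submodule A N) : Prop :=
  V ≠ ⊥ ∧ ∀ x : A, x • V = V ∨ ∃ k : ℕ, x ^ k • V = ⊥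

lemma exists_secondary_decomposition [IsArtinian A N] (U : Submodule A N) :
    ∃ F : Finset (Submodule A N), (∀ V ∈ F, IsSecondary V) ∧ F.sup id = U := by
  classical
  induction U using IsArtinian.induction with
  | _ U ih =>
    by_cases hU : U = ⊥
    · exact ⟨∅, by simp, by simp [hU]⟩
    by_cases hsec : IsSecondary U
    · exact ⟨{U}, by simpa, by simp⟩
    simp only [IsSecondary, not_and, not_forall, not_or, not_exists] at hsec
    obtain ⟨x, hx, hnil⟩ := hsec hU
    have hle : ∀ (y : A) (V : Submodule A N), y • V ≤ V := by
      rintro y V _ ⟨v, hv, rfl⟩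
      exact V.smul_mem y hv
    obtain ⟨k, hk⟩ := exists_stable_of_antitone_of_le (P := (⊤ : Submodule A N))
      (f := fun n => x ^ n • U)
      (antitone_nat_of_succ_le fun n => by rw [pow_succ', mul_smul]; exact hle _ _) (by simp)
    let K := LinearMap.ker (LinearMap.lsmul A N (x ^ k)) ⊓ U
    have hV : x ^ k • U < U := by
      refine lt_of_le_of_ne (hle _ _) fun h => hx ?_
      have := hk (k + 1) (Nat.le_succ k)
      simp only [pow_succ', mul_smul, h] at this
      exact this
    have hK : K < U := by
      refine lt_of_le_of_ne inf_le_right fun h => hnil k ?_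
      rw [eq_bot_iff]
      rintro _ ⟨u, hu, rfl⟩
      have hu' : u ∈ K := h ▸ hu
      simpa using hu'.1
    have hsum : (x ^ k • U) ⊔ K = U := by
      refine le_antisymm (sup_le hV.le hK.le) fun u hu => ?_
      have h1 : x ^ k • u ∈ x ^ (k + k) • U := by
        rw [hk (k + k) (Nat.le_add_right k k)]
        exact Submodule.smul_mem_pointwise_smul _ _ _ hu
      obtain ⟨v, hv, hvu⟩ := (Submodule.mem_smul_pointwise_iff_exists _ _ _).1 h1
      rw [pow_add, mul_smul] at hvu
      rw [Submodule.mem_sup]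
      refine ⟨x ^ k • v, Submodule.smul_mem_pointwise_smul _ _ _ hv, u - x ^ k • v, ⟨?_, ?_⟩,
        by simp⟩
      · simp [smul_sub, hvu]
      · exact U.sub_mem hu (U.smul_mem _ hv)
    obtain ⟨F, hF, hFV⟩ := ih _ hV
    obtain ⟨G, hG, hGK⟩ := ih _ hK
    refine ⟨F ∪ G, fun W hW => ?_, ?_⟩
    · rcases Finset.mem_union.1 hW with h | h
      exacts [hF W h, hG W h]
    · rw [Finset.sup_union, hFV, hGK, hsum]

lemma IsSecondary.isPrime_radical_annihilator {V : Submodule A N} (hV : IsSecondary V) :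
    (Module.annihilator A V).radical.IsPrime := by
  have hmem : ∀ x : A, x ∈ (Module.annihilator A V).radical ↔ ∃ k : ℕ, x ^ k • V = ⊥ := by
    intro x
    rw [Ideal.mem_radical_iff]
    refine exists_congr fun k => ?_
    rw [Module.mem_annihilator, eq_bot_iff]
    refine ⟨?_, fun h v => ?_⟩
    · rintro h _ ⟨v, hv, rfl⟩
      simpa using congrArg Subtype.val (h ⟨v, hv⟩)
    · refine Subtype.ext ?_
      simpa using h (Submodule.smul_mem_pointwise_smul _ _ _ v.2)
  have hpow : ∀ x : A, x • V = V → ∀ k : ℕ, x ^ k • V = V := by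
    intro x hx k
    induction k with
    | zero => simp
    | succ k ih => rw [pow_succ, mul_smul, hx, ih]
  refine ⟨fun h => ?_, fun {x y} hxy => ?_⟩
  · obtain ⟨k, hk⟩ := (hmem 1).1 (h ▸ Submodule.mem_top)
    exact hV.1 (by simpa using hk)
  · rw [hmem, hmem]
    rw [hmem] at hxy
    rcases hV.2 x with hx | hx
    · refine Or.inr ?_
      obtain ⟨k, hk⟩ := hxy
      refine ⟨k, ?_⟩
      rwa [mul_comm, mul_pow, mul_smul, hpow x hx k] at hk
    · exact Or.inl hx

lemma exists_smul_surjective_of_smul_top_eq_top [IsNoetherianRing A] [IsArtinian A N]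
    {𝔞 : Ideal A} (h : 𝔞 • (⊤ : Submodule A N) = ⊤) :
    ∃ x ∈ 𝔞, ∀ w : N, ∃ w' : N, x • w' = w := by
  classical
  obtain ⟨F, hF, hFtop⟩ := exists_secondary_decomposition (⊤ : Submodule A N)
  let p : Submodule A N → Ideal A := fun V => (Module.annihilator A V).radical
  let G := F.filter fun V => ¬ 𝔞 ≤ p V
  have hGtop : G.sup id = ⊤ := by
    have hpow : ∀ k : ℕ, 𝔞 ^ k • (⊤ : Submodule A N) = ⊤ := by
      intro k
      induction k with
      | zero => simp
      | succ k ih => rw [pow_succ, Submodule.mul_smul, h, ih]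
    have key : ∀ H : Finset (Submodule A N), H ⊆ F →
        ∃ k : ℕ, 𝔞 ^ k • (H.sup id) ≤ G.sup id := by
      intro H
      induction H using Finset.induction_on with
      | empty => intro _; exact ⟨0, by simp⟩
      | insert V H hVH ih =>
        intro hsub
        obtain ⟨k, hk⟩ := ih fun W hW => hsub (Finset.mem_insert_of_mem hW)
        have hVF : V ∈ F := hsub (Finset.mem_insert_self _ _)
        rw [Finset.sup_insert]
        by_cases hV : 𝔞 ≤ p V
        · obtain ⟨l, hl⟩ := Ideal.exists_pow_le_of_le_radical_of_fg hV
            (IsNoetherian.noetherian 𝔞)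
          refine ⟨l + k, ?_⟩
          rw [Submodule.smul_sup]
          refine sup_le ?_ ?_
          · refine Submodule.smul_le.2 fun r hr v hv => ?_
            have := Module.mem_annihilator.1 (hl (Ideal.pow_le_pow_right (Nat.le_add_right l k) hr))
              ⟨v, hv⟩
            have h0 : r • v = 0 := congrArg Subtype.val this
            simp only [h0, Submodule.zero_mem]
          · exact (Submodule.smul_mono_left (Ideal.pow_le_pow_right (Nat.le_add_left k l))).trans hk
        · refine ⟨k, ?_⟩
          rw [Submodule.smul_sup]
          refine sup_le (Submodule.smul_le_right.trans ?_) hk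
          exact Finset.le_sup (f := id) (Finset.mem_filter.2 ⟨hVF, hV⟩)
    obtain ⟨k, hk⟩ := key F subset_rfl
    rw [hFtop, hpow k] at hk
    exact top_le_iff.1 hk
  obtain ⟨x, hx, hxG⟩ : ∃ x ∈ 𝔞, ∀ V ∈ G, x ∉ p V := by
    by_contra! hcon
    have hsub : (𝔞 : Set A) ⊆ ⋃ V ∈ (G : Set (Submodule A N)), (p V : Set A) := by
      intro x hx
      obtain ⟨V, hV, hxV⟩ := hcon x hx
      exact Set.mem_biUnion (Finset.mem_coe.2 hV) hxV
    obtain ⟨V, hV, hle⟩ := (Ideal.subset_union_prime (f := p) ⊥ ⊥ (fun V hV _ _ =>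
      (hF V (Finset.mem_filter.1 hV).1).isPrime_radical_annihilator)).1 hsub
    exact (Finset.mem_filter.1 hV).2 hle
  refine ⟨x, hx, fun w => ?_⟩
  have hle : (⊤ : Submodule A N) ≤ LinearMap.range (LinearMap.lsmul A N x) := by
    rw [← hGtop]
    refine Finset.sup_le fun V hV v hv => ?_
    rcases (hF V (Finset.mem_filter.1 hV).1).2 x with h | ⟨k, hk⟩
    · rw [id, ← h] at hv
      obtain ⟨v', -, hv'⟩ := (Submodule.mem_smul_pointwise_iff_exists _ _ _).1 hv
      exact ⟨v', hv'⟩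
    · refine absurd (Ideal.mem_radical_iff.2 ⟨k, Module.mem_annihilator.2 fun v' => ?_⟩) (hxG V hV)
      refine Subtype.ext ?_
      have := Submodule.smul_mem_pointwise_smul _ (x ^ k) _ v'.2
      rw [hk] at this
      simpa using this
  exact hle (Submodule.mem_top (x := w))

end ArtinianModules

section CommutativeAlgebra

/-- Over a ring `A ⧸ c` of dimension zero, Noetherian and Artinian modules coincide. -/
lemma isNoetherian_iff_isArtinian_of_forall_smul_eq_zero {A : Type*} [CommRing A]
    [IsNoetherianRing A] {c : Ideal A} (hc : ∀ p : Ideal A, p.IsPrime → c ≤ p → p.IsMaximal)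
    {X : Type*} [AddCommGroup X] [Module A X] (hX : ∀ r ∈ c, ∀ m : X, r • m = 0) :
    IsNoetherian A X ↔ IsArtinian A X := by
  have hT : Module.IsTorsionBySet A X (c : Set A) := fun m r => hX r.1 r.2 m
  let _ := hT.module
  have _ := hT.isScalarTower (S := A)
  have _ : Ring.KrullDimLE 0 (A ⧸ c) := by
    rw [Ring.krullDimLE_zero_iff]
    intro p hp
    have h1 : (p.comap (Ideal.Quotient.mk c)).IsMaximal :=
      hc _ inferInstance (by
        intro r hr
        rw [Ideal.mem_comap, Ideal.Quotient.eq_zero_iff_mem.2 hr]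
        exact p.zero_mem)
    have h2 := Ideal.map_eq_top_or_isMaximal_of_surjective (Ideal.Quotient.mk c)
      Ideal.Quotient.mk_surjective h1
    rw [Ideal.map_comap_of_surjective _ Ideal.Quotient.mk_surjective] at h2
    exact h2.resolve_left hp.ne_top
  have _ : IsArtinianRing (A ⧸ c) :=
    isArtinianRing_iff_isNoetherianRing_krullDimLE_zero.2 ⟨inferInstance, inferInstance⟩
  have h := IsSemiprimaryRing.isNoetherian_iff_isArtinian (R := A ⧸ c) (M := X)
  let f : X →ₛₗ[Ideal.Quotient.mk c] X :=
    { toFun := id, map_add' := fun _ _ => rfl, map_smul' := fun _ _ => rfl }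
  have _ : RingHomSurjective (Ideal.Quotient.mk c) := ⟨Ideal.Quotient.mk_surjective⟩
  rw [LinearMap.isNoetherian_iff_of_bijective f Function.bijective_id,
    LinearMap.isArtinian_iff_of_bijective f Function.bijective_id, h]

/-- If `dim A ⧸ 𝔞 = 1`, inverting the complement of the union of the nonmaximal primes over `𝔞`
makes `𝔞` zero-dimensional. -/
lemma exists_submonoid_of_ringKrullDim_quotient_eq_one {R : Type*} [CommRing R]
    [IsNoetherianRing R] {𝔞 : Ideal R} (hdim : ringKrullDim (R ⧸ 𝔞) = 1) :
    ∃ S : Submonoid R,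
      (∀ q : Ideal (Localization S), q.IsPrime →
        𝔞.map (algebraMap R (Localization S)) ≤ q → q.IsMaximal) ∧
      (∀ p : Ideal R, p.IsPrime → 𝔞 ≤ p → ∀ s ∈ S, s ∈ p → p.IsMaximal) := by
  classical
  have hmin : ∀ p : Ideal R, p.IsPrime → 𝔞 ≤ p → p ∈ 𝔞.minimalPrimes ∨ p.IsMaximal := by
    intro p hp hap
    have hdim' : Ring.KrullDimLE 1 (R ⧸ 𝔞) := Ring.krullDimLE_iff.2 hdim.le
    have hp' : (p.map (Ideal.Quotient.mk 𝔞)).IsPrime :=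
      Ideal.map_isPrime_of_surjective Ideal.Quotient.mk_surjective (by simpa using hap)
    have hcm : (p.map (Ideal.Quotient.mk 𝔞)).comap (Ideal.Quotient.mk 𝔞) = p := by
      rw [Ideal.comap_map_of_surjective _ Ideal.Quotient.mk_surjective]
      simpa [← RingHom.ker_eq_comap_bot] using hap
    rcases Ring.krullDimLE_one_iff.1 hdim' _ hp' with h | h
    · left
      rw [Ideal.minimalPrimes_eq_comap]
      exact ⟨_, h, hcm⟩
    · right
      rw [← hcm]
      exact Ideal.comap_isMaximal_of_surjective _ Ideal.Quotient.mk_surjective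
  let S : Submonoid R :=
    { carrier := {s | ∀ p ∈ 𝔞.minimalPrimes, ¬ p.IsMaximal → s ∉ p}
      one_mem' := fun p hp _ h => hp.1.1.ne_top ((Ideal.eq_top_iff_one _).2 h)
      mul_mem' := fun ha hb p hp hm h =>
        (hp.1.1.mem_or_mem h).elim (ha p hp hm) (hb p hp hm) }
  have hS : ∀ s, s ∈ S ↔ ∀ p ∈ 𝔞.minimalPrimes, ¬ p.IsMaximal → s ∉ p := fun s => Iff.rfl
  have hfin := Ideal.finite_minimalPrimes_of_isNoetherianRing R 𝔞
  have hcov : ∀ p : Ideal R, Disjoint (S : Set R) p → ∃ p₀ ∈ 𝔞.minimalPrimes, p ≤ p₀ := by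
    intro p hp
    let F := hfin.toFinset.filter fun p => ¬ p.IsMaximal
    have hsub : (p : Set R) ⊆ ⋃ i ∈ (F : Set (Ideal R)), (i : Set R) := by
      intro x hx
      have hxS : x ∉ S := fun h => Set.disjoint_left.1 hp h hx
      rw [hS] at hxS
      push Not at hxS
      obtain ⟨p₁, h1, h2, h3⟩ := hxS
      exact Set.mem_biUnion 
        (Finset.mem_coe.2 (Finset.mem_filter.2 ⟨hfin.mem_toFinset.2 h1, h2⟩)) h3
    obtain ⟨p₀, h0, hle⟩ := (Ideal.subset_union_prime (f := fun i : Ideal R => i) ⊥ ⊥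
      (fun i hi _ _ =>
        (hfin.mem_toFinset.1 (Finset.mem_filter.1 hi).1).1.1)).1 hsub
    exact ⟨p₀, hfin.mem_toFinset.1 (Finset.mem_filter.1 h0).1, hle⟩
  refine ⟨S, fun q hq haq => ?_, fun p hp hap s hs hsp => ?_⟩
  · obtain ⟨q', hq', hle⟩ := Ideal.exists_le_maximal q hq.ne_top
    have h1 := (IsLocalization.isPrime_iff_isPrime_disjoint S (Localization S) q).1 hq
    have h2 := (IsLocalization.isPrime_iff_isPrime_disjoint S (Localization S) q').1 hq'.isPrime
    obtain ⟨p₀, h0, hle0⟩ := hcov _ h2.2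
    have h3 : q.under R ≤ q'.under R := Ideal.comap_mono hle
    have h4 : p₀ ≤ q.under R := h0.2 ⟨h1.1, Ideal.map_le_iff_le_comap.1 haq⟩ (h3.trans hle0)
    have h5 : q.under R = q'.under R := le_antisymm h3 (hle0.trans h4)
    have h6 : q = q' := by
      rw [← IsLocalization.map_under S (Localization S) q, h5, IsLocalization.map_under S]
    rwa [h6]
  · by_contra hm
    exact (hS s).1 hs p ((hmin p hp hap).resolve_right hm) hm hsp

lemma exists_mem_forall_smul_eq_zero_of_fg {R : Type*} [CommRing R] {S : Submonoid R}
    {W : Type*} [AddCommGroup W] [Module R W] {P : Submodule R W} (hP : P.FG)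
    (h : ∀ w ∈ P, ∃ s ∈ S, s • w = 0) : ∃ s ∈ S, ∀ w ∈ P, s • w = 0 := by
  classical
  obtain ⟨t, rfl⟩ := hP
  have h' : ∀ w : W, ∃ s ∈ S, w ∈ t → s • w = 0 := fun w => by
    by_cases hw : w ∈ t
    · obtain ⟨s, hs, h0⟩ := h w (Submodule.subset_span hw)
      exact ⟨s, hs, fun _ => h0⟩
    · exact ⟨1, S.one_mem, fun h => absurd h hw⟩
  choose g hgS hg using h'
  refine ⟨∏ m ∈ t, g m, S.prod_mem fun m _ => hgS _, fun m hm => ?_⟩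
  induction hm using Submodule.span_induction with
  | mem m hm => rw [← Finset.prod_erase_mul t _ hm, mul_smul, hg m hm, smul_zero]
  | zero => simp
  | add a b _ _ ha hb => rw [smul_add, ha, hb, add_zero]
  | smul r a _ ha => rw [smul_comm, ha, smul_zero]

/-- If `W` is torsion for `𝔞` and for a multiplicative set meeting nonmaximal primes over `𝔞`
trivially, then `W` is Artinian as soon as `0 :_W 𝔞` is finitely generated. -/
lemma IsPowTorsion.isArtinian_of_finite_torsionBySet {R : Type*} [CommRing R]
    [IsNoetherianRing R] {𝔞 : Ideal R} {S : Submonoid R}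
    (hS : ∀ p : Ideal R, p.IsPrime → 𝔞 ≤ p → ∀ s ∈ S, s ∈ p → p.IsMaximal)
    {W : Type*} [AddCommGroup W] [Module R W] (hW : IsPowTorsion 𝔞 W)
    (hWS : ∀ w : W, ∃ s ∈ S, s • w = 0)
    (hfin : Module.Finite R (Submodule.torsionBySet R W (𝔞 : Set R))) : IsArtinian R W := by
  refine hW.isArtinian ?_
  have key : ∃ s ∈ S, ∀ m : Submodule.torsionBySet R W (𝔞 : Set R), s • m = 0 := by
    obtain ⟨s, hs, h⟩ := exists_mem_forall_smul_eq_zero_of_fg (S := S)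
      (Module.Finite.iff_fg.1 hfin) fun w _ => hWS w
    exact ⟨s, hs, fun m => Subtype.ext (h m.1 m.2)⟩
  obtain ⟨s, hs, hkill⟩ := key
  refine (isNoetherian_iff_isArtinian_of_forall_smul_eq_zero (c := 𝔞 ⊔ Ideal.span {s}) ?_ ?_).1
    (isNoetherian_of_isNoetherianRing_of_finite R _)
  · intro p hp hle
    exact hS p hp (le_sup_left.trans hle) s hs
      (hle ((le_sup_right : Ideal.span {s} ≤ _) (Ideal.mem_span_singleton_self s)))
  · intro r hr m
    have hle : 𝔞 ⊔ Ideal.span {s} ≤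
        Module.annihilator R (Submodule.torsionBySet R W (𝔞 : Set R)) := by
      refine sup_le (fun r hr => Module.mem_annihilator.2 fun m =>
        Subtype.ext (mem_torsionBySet_ideal.1 m.2 r hr)) ?_
      rw [Ideal.span_singleton_le_iff_mem]
      exact Module.mem_annihilator.2 hkill
    exact Module.mem_annihilator.1 (hle hr) m

/-- In an Artinian module, high powers of `𝔟` span a submodule divisible by an element of `𝔟`. -/
lemma exists_pow_smul_top_divisible {A : Type*} [CommRing A] [IsNoetherianRing A] (𝔟 : Ideal A)
    (X : Type*) [AddCommGroup X] [Module A X] [IsArtinian A X] :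
    ∃ n : ℕ, ∃ y ∈ 𝔟, ∀ w ∈ 𝔟 ^ n • (⊤ : Submodule A X),
      ∃ w' ∈ 𝔟 ^ n • (⊤ : Submodule A X), y • w' = w := by
  obtain ⟨n, hn⟩ := exists_stable_of_antitone_of_le (P := (⊤ : Submodule A X))
    (f := fun n => 𝔟 ^ n • (⊤ : Submodule A X))
    (fun i j h => Submodule.smul_mono_left (Ideal.pow_le_pow_right h)) (by simp)
  let W := 𝔟 ^ n • (⊤ : Submodule A X)
  have hW : 𝔟 • W = W := by
    have := hn (n + 1) (Nat.le_succ n)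
    rwa [pow_succ', Submodule.mul_smul] at this
  have hW' : 𝔟 • (⊤ : Submodule A W) = ⊤ := by
    apply Submodule.map_injective_of_injective W.injective_subtype
    rw [Submodule.map_smul'', Submodule.map_top, Submodule.range_subtype, hW]
  obtain ⟨y, hy, h⟩ := exists_smul_surjective_of_smul_top_eq_top hW'
  refine ⟨n, y, hy, fun w hw => ?_⟩
  obtain ⟨w', hw'⟩ := h ⟨w, hw⟩
  exact ⟨w'.1, w'.2, congrArg Subtype.val hw'⟩

lemma exists_fg_map_mkQ_eq {A : Type*} [Ring A] {X : Type*} [AddCommGroup X] [Module A X]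
    {W : Submodule A X} {Q : Submodule A (X ⧸ W)} (hQ : Q.FG) :
    ∃ P : Submodule A X, P.FG ∧ P.map W.mkQ = Q := by
  classical
  obtain ⟨t, rfl⟩ := hQ
  refine ⟨Submodule.span A (t.image (Function.surjInv W.mkQ_surjective) : Finset X),
    ⟨_, rfl⟩, ?_⟩
  rw [Submodule.map_span, Finset.coe_image, Set.image_image]
  simp [Function.surjInv_eq]

lemma IsPowTorsion.exists_finite_quotient_of_zero_dim {A : Type*} [CommRing A]
    [IsNoetherianRing A] {𝔟 : Ideal A} (hb : ∀ p : Ideal A, p.IsPrime → 𝔟 ≤ p → p.IsMaximal)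
    {X : Type*} [AddCommGroup X] [Module A X] (hX : IsPowTorsion 𝔟 X)
    (hfin : Module.Finite A (Submodule.torsionBySet A X (𝔟 : Set A))) :
    ∃ y ∈ 𝔟, ∃ P : Submodule A X, P.FG ∧ ∀ w : X, ∃ p ∈ P, ∃ w' : X, w = p + y • w' := by
  have h1 : IsArtinian A (Submodule.torsionBySet A X (𝔟 : Set A)) :=
    (isNoetherian_iff_isArtinian_of_forall_smul_eq_zero hb fun r hr m =>
      Subtype.ext (mem_torsionBySet_ideal.1 m.2 r hr)).1
      (isNoetherian_of_isNoetherianRing_of_finite A _)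
  have h2 : IsArtinian A X := hX.isArtinian h1
  obtain ⟨n, y, hy, hdiv⟩ := exists_pow_smul_top_divisible 𝔟 X
  have h3 : IsNoetherian A (X ⧸ (𝔟 ^ n • (⊤ : Submodule A X))) := by
    refine (isNoetherian_iff_isArtinian_of_forall_smul_eq_zero (c := 𝔟 ^ n)
      (fun p hp hle => hb p hp (hp.le_of_pow_le hle)) fun r hr m => ?_).2 inferInstance
    obtain ⟨m, rfl⟩ := Submodule.mkQ_surjective _ m
    rw [← map_smul, Submodule.mkQ_apply, Submodule.Quotient.mk_eq_zero]
    exact Submodule.smul_mem_smul hr Submodule.mem_top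
  obtain ⟨P, hPfg, hP⟩ := exists_fg_map_mkQ_eq (IsNoetherian.noetherian
    (⊤ : Submodule A (X ⧸ (𝔟 ^ n • (⊤ : Submodule A X)))))
  refine ⟨y, hy, P, hPfg, fun w => ?_⟩
  have hw : Submodule.mkQ _ w ∈ P.map (𝔟 ^ n • (⊤ : Submodule A X)).mkQ := hP ▸ Submodule.mem_top
  obtain ⟨p, hp, hpw⟩ := hw
  have hmem : w - p ∈ 𝔟 ^ n • (⊤ : Submodule A X) := by
    rw [← Submodule.Quotient.mk_eq_zero, ← Submodule.mkQ_apply, map_sub, hpw, sub_self]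
  obtain ⟨w', -, hw'⟩ := hdiv _ hmem
  exact ⟨p, hp, w', by rw [hw', add_sub_cancel]⟩

lemma IsPowTorsion.exists_localized_finite_quotient {R : Type*} [CommRing R] [IsNoetherianRing R]
    {𝔞 : Ideal R} {S : Submonoid R}
    (hS : ∀ q : Ideal (Localization S), q.IsPrime →
      𝔞.map (algebraMap R (Localization S)) ≤ q → q.IsMaximal)
    {N : Type*} [AddCommGroup N] [Module R N] (hN : IsPowTorsion 𝔞 N)
    (hfin : Module.Finite R (Submodule.torsionBySet R N (𝔞 : Set R))) :
    ∃ x ∈ 𝔞, ∃ P : Submodule R N, P.FG ∧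
      ∀ w : N, ∃ s ∈ S, ∃ p ∈ P, ∃ w' : N, s • w = p + x • w' := by
  let A := Localization S
  let f := LocalizedModule.mkLinearMap S N
  have _ : IsNoetherianRing A := IsLocalization.isNoetherianRing S A inferInstance
  have htors : IsPowTorsion (𝔞.map (algebraMap R A)) (LocalizedModule S N) := by
    intro z
    obtain ⟨⟨m, s⟩, rfl⟩ := IsLocalizedModule.mk'_surjective S f z
    obtain ⟨n, hn⟩ := hN m
    have hle : (𝔞 ^ n).map (algebraMap R A) ≤
        LinearMap.ker (LinearMap.toSpanSingleton A _ (IsLocalizedModule.mk' f m s)) := by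
      refine Ideal.map_le_iff_le_comap.2 fun r hr => ?_
      rw [Ideal.mem_comap, LinearMap.mem_ker, LinearMap.toSpanSingleton_apply, algebraMap_smul,
        ← IsLocalizedModule.mk'_smul, hn r hr, IsLocalizedModule.mk'_zero]
    refine ⟨n, fun r hr => ?_⟩
    rw [← Ideal.map_pow] at hr
    exact hle hr
  have hsoc : Module.Finite A (Submodule.torsionBySet A (LocalizedModule S N)
      ((𝔞.map (algebraMap R A) : Ideal A) : Set A)) := by
    let T := Submodule.torsionBySet R N (𝔞 : Set R)
    have hT : (T.localized' A S f).FG := by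
      classical
      obtain ⟨t, ht⟩ : T.FG := Module.Finite.iff_fg.1 hfin
      rw [← ht, Submodule.localized'_span, ← Finset.coe_image]
      exact ⟨_, rfl⟩
    have hle : Submodule.torsionBySet A (LocalizedModule S N)
        ((𝔞.map (algebraMap R A) : Ideal A) : Set A) ≤ T.localized' A S f := by
      intro z hz
      obtain ⟨⟨m, s⟩, rfl⟩ := IsLocalizedModule.mk'_surjective S f z
      have hz' : ∀ r ∈ 𝔞, f (r • m) = 0 := by
        intro r hr
        have := mem_torsionBySet_ideal.1 hz _ (Ideal.mem_map_of_mem _ hr)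
        rw [algebraMap_smul, Function.uncurry_apply_pair, ← IsLocalizedModule.mk'_smul,
          IsLocalizedModule.mk'_eq_zero] at this
        exact this
      obtain ⟨c, hc, hcm⟩ := exists_mem_forall_smul_eq_zero_of_fg (S := S)
        (P := Submodule.map (LinearMap.toSpanSingleton R N m) 𝔞)
        (Submodule.FG.map _ (IsNoetherian.noetherian 𝔞)) (by
          rintro _ ⟨r, hr, rfl⟩
          obtain ⟨c, hc⟩ := (IsLocalizedModule.eq_zero_iff S f).1 (hz' r hr)
          exact ⟨c, c.2, hc⟩)
      refine (Submodule.mem_localized' A S f T _).2 ⟨c • m, ?_, ⟨c, hc⟩ * s, ?_⟩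
      · refine mem_torsionBySet_ideal.2 fun r hr => ?_
        rw [smul_comm]
        exact hcm _ ⟨r, hr, rfl⟩
      · exact IsLocalizedModule.mk'_cancel_left (f := f) m ⟨c, hc⟩ s
    have hN : IsNoetherian A (T.localized' A S f) := isNoetherian_of_fg_of_noetherian _ hT
    exact Module.Finite.of_injective _ (Submodule.inclusion_injective hle)
  obtain ⟨y, hy, Q, hQ, hdiv⟩ := htors.exists_finite_quotient_of_zero_dim hS hsoc
  obtain ⟨⟨x, s⟩, hxs⟩ := (IsLocalization.mem_map_algebraMap_iff S A).1 hy
  obtain ⟨P, hP, hPQ⟩ : ∃ P : Submodule R N, P.FG ∧ Q ≤ P.localized' A S f := by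
    classical
    obtain ⟨t, rfl⟩ := hQ
    choose g hg using IsLocalizedModule.mk'_surjective S f
    refine ⟨Submodule.span R (t.image fun z => (g z).1 : Finset N), ⟨_, rfl⟩, ?_⟩
    refine Submodule.span_le.2 fun z hz => (Submodule.mem_localized' A S f _ _).2
      ⟨(g z).1, Submodule.subset_span ?_, (g z).2, hg z⟩
    exact Finset.mem_coe.2 (Finset.mem_image_of_mem _ hz)
  refine ⟨x, x.2, P, hP, fun w => ?_⟩
  obtain ⟨q, hq, z, hz⟩ := hdiv (f w)
  obtain ⟨p, hp, s₁, rfl⟩ := (Submodule.mem_localized' A S f P q).1 (hPQ hq)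
  obtain ⟨⟨u, s₂⟩, rfl⟩ := IsLocalizedModule.mk'_surjective S f z
  have h : f ((s * s₁ * s₂ : S) • w) = f ((s * s₂ : S) • p + (x : R) • s₁ • u) := by
    have hy' : ∀ z : LocalizedModule S N, s • y • z = (x : R) • z := fun z => by
      rw [← algebraMap_smul A (x : R) z, ← hxs, mul_comm, mul_smul, algebraMap_smul,
        Submonoid.smul_def]
    have h1 : s₁ • IsLocalizedModule.mk' f p s₁ = f p := IsLocalizedModule.mk'_cancel' f p s₁
    have h2 : s₂ • IsLocalizedModule.mk' f u s₂ = f u := IsLocalizedModule.mk'_cancel' f u s₂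
    have hf : ∀ (c : S) (m : N), f (c • m) = c • f m := fun c m => map_smul f (c : R) m
    have hyc : ∀ (c : S) (z : LocalizedModule S N), y • c • z = c • y • z := fun c z =>
      smul_comm y (c : R) z
    rw [hf, hz, map_add, hf, map_smul, hf, smul_add, ← h1, ← h2, ← hy' (s₁ • _)]
    simp only [hyc, ← mul_smul, Function.uncurry_apply_pair]
    congr 2 <;> ac_rfl
  obtain ⟨c, hc⟩ := (IsLocalizedModule.eq_iff_exists S f).1 h
  refine ⟨(c * (s * s₁ * s₂) : S), (c * (s * s₁ * s₂)).2, (c * (s * s₂) : S) • p,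
    P.smul_of_tower_mem _ hp, c • s₁ • u, ?_⟩
  rw [← Submonoid.smul_def, mul_smul, hc, smul_add, mul_smul c, smul_comm c (x : R)]

end CommutativeAlgebra

section ExtFinite

open Abelian

variable {R : Type u} [CommRing R]

lemma Module.Finite.of_exact_of_isNoetherianRing {R : Type*} [CommRing R] [IsNoetherianRing R]
    {A B C : Type*} [AddCommGroup A] [Module R A] [AddCommGroup B] [Module R B] [AddCommGroup C]
    [Module R C] {f : A →ₗ[R] B} {g : B →ₗ[R] C} (h : Function.Exact f g)
    (hA : Module.Finite R A) (hC : Module.Finite R C) : Module.Finite R B :=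
  Module.Finite.of_exact (f := f) (g := g.rangeRestrict)
    (by rw [LinearMap.exact_iff, LinearMap.ker_rangeRestrict, h.linearMap_ker_eq])
    g.surjective_rangeRestrict

/-- The map induced by a linear map on `Ext^i(X, -)`. -/
noncomputable def extMap (X : ModuleCat.{u} R) {N N' : Type u} [AddCommGroup N] [Module R N]
    [AddCommGroup N'] [Module R N'] (f : N →ₗ[R] N') (i : ℕ) :
    Abelian.Ext X (ModuleCat.of R N) i →ₗ[R] Abelian.Ext X (ModuleCat.of R N') i :=
  (Ext.mk₀ (ModuleCat.ofHom f)).postcompOfLinear R X (add_zero i)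

variable {N N₁ N₂ N₃ : Type u} [AddCommGroup N] [Module R N] [AddCommGroup N₁] [Module R N₁]
  [AddCommGroup N₂] [Module R N₂] [AddCommGroup N₃] [Module R N₃]

lemma extMap_apply (X : ModuleCat.{u} R) (f : N₁ →ₗ[R] N₂) (i : ℕ)
    (x : Abelian.Ext X (ModuleCat.of R N₁) i) :
    extMap X f i x = x.comp (Ext.mk₀ (ModuleCat.ofHom f)) (add_zero i) := rfl

lemma extMap_comp_apply (X : ModuleCat.{u} R) (f : N₁ →ₗ[R] N₂) (g : N₂ →ₗ[R] N₃) (i : ℕ)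
    (x : Abelian.Ext X (ModuleCat.of R N₁) i) :
    extMap X (g ∘ₗ f) i x = extMap X g i (extMap X f i x) := by
  simp [extMap_apply, ModuleCat.ofHom_comp]

lemma extMap_id_apply (X : ModuleCat.{u} R) (i : ℕ)
    (x : Abelian.Ext X (ModuleCat.of R N) i) :
    extMap X (LinearMap.id : N →ₗ[R] N) i x = x := by
  simp [extMap_apply, ModuleCat.ofHom_id]

lemma extMap_lsmul_apply (X : ModuleCat.{u} R) (r : R) (i : ℕ)
    (x : Abelian.Ext X (ModuleCat.of R N) i) :
    extMap X (LinearMap.lsmul R N r) i x = r • x := by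
  have : ModuleCat.ofHom (LinearMap.lsmul R N r) = r • 𝟙 (ModuleCat.of R N) := rfl
  rw [extMap_apply, this, Ext.mk₀_smul, Ext.comp_smul, Ext.comp_mk₀_id]

lemma extMap_zero_apply (X : ModuleCat.{u} R) (i : ℕ)
    (x : Abelian.Ext X (ModuleCat.of R N₁) i) :
    extMap X (0 : N₁ →ₗ[R] N₂) i x = 0 := by
  have : ModuleCat.ofHom (0 : N₁ →ₗ[R] N₂) = 0 := rfl
  rw [extMap_apply, this, Ext.mk₀_zero, Ext.comp_zero]

lemma smul_ext_eq_zero {𝔞 : Ideal R} {r : R} (hr : r ∈ 𝔞) {Y : ModuleCat.{u} R} (i : ℕ)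
    (x : Abelian.Ext (ModuleCat.of R (R ⧸ 𝔞)) Y i) : r • x = 0 := by
  have h : r • 𝟙 (ModuleCat.of R (R ⧸ 𝔞)) = 0 := by
    refine ModuleCat.hom_ext (LinearMap.ext fun m => ?_)
    obtain ⟨m, rfl⟩ := Ideal.Quotient.mk_surjective m
    change r • Ideal.Quotient.mk 𝔞 m = 0
    rw [← Ideal.Quotient.mk_eq_mk, ← Submodule.Quotient.mk_smul, Submodule.Quotient.mk_eq_zero]
    exact 𝔞.mul_mem_right _ hr
  rw [← Ext.mk₀_id_comp x, ← Ext.smul_comp, ← Ext.mk₀_smul, h, Ext.mk₀_zero, Ext.zero_comp]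

/-- A pair of linear maps forming a short exact sequence. -/
structure IsShortExact (f : N₁ →ₗ[R] N₂) (g : N₂ →ₗ[R] N₃) : Prop where
  inj : Function.Injective f
  exact : Function.Exact f g
  surj : Function.Surjective g

lemma isShortExact_subtype_mkQ (P : Submodule R N) : IsShortExact P.subtype P.mkQ :=
  ⟨P.injective_subtype, LinearMap.exact_subtype_mkQ P, P.mkQ_surjective⟩

lemma isShortExact_ker_rangeRestrict (f : N₁ →ₗ[R] N₂) :
    IsShortExact (LinearMap.ker f).subtype f.rangeRestrict :=
  ⟨Submodule.injective_subtype _, by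
    rw [LinearMap.exact_iff, LinearMap.ker_rangeRestrict, Submodule.range_subtype],
    f.surjective_rangeRestrict⟩

lemma isShortExact_ker_of_surjective (f : N₁ →ₗ[R] N₂) (hf : Function.Surjective f) :
    IsShortExact (LinearMap.ker f).subtype f :=
  ⟨Submodule.injective_subtype _, by
    rw [LinearMap.exact_iff, Submodule.range_subtype], hf⟩

namespace IsShortExact

variable {f : N₁ →ₗ[R] N₂} {g : N₂ →ₗ[R] N₃}

lemma comp_eq_zero (h : IsShortExact f g) : g ∘ₗ f = 0 := h.exact.linearMap_comp_eq_zero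

lemma shortExact (h : IsShortExact f g) : (ShortComplex.mk (ModuleCat.ofHom f) (ModuleCat.ofHom g)
    (by rw [← ModuleCat.ofHom_comp, h.comp_eq_zero]; rfl)).ShortExact :=
  ModuleCat.shortComplex_shortExact _ h.exact h.inj h.surj

/-- The connecting map `Ext^i(X, N₃) → Ext^{i+1}(X, N₁)`. -/
noncomputable def extδ (h : IsShortExact f g) (X : ModuleCat.{u} R) (i : ℕ) :
    Abelian.Ext X (ModuleCat.of R N₃) i →ₗ[R] Abelian.Ext X (ModuleCat.of R N₁) (i + 1) :=
  h.shortExact.extClass.postcompOfLinear R X rfl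

lemma extδ_apply (h : IsShortExact f g) (X : ModuleCat.{u} R) (i : ℕ)
    (x : Abelian.Ext X (ModuleCat.of R N₃) i) :
    h.extδ X i x = x.comp h.shortExact.extClass rfl := rfl

lemma ext_exact₂ (h : IsShortExact f g) (X : ModuleCat.{u} R) (i : ℕ) :
    Function.Exact (extMap X f i) (extMap X g i) := by
  refine fun x => ⟨fun hx => Ext.covariant_sequence_exact₂ X h.shortExact x hx, ?_⟩
  rintro ⟨y, rfl⟩
  rw [← extMap_comp_apply, h.comp_eq_zero, extMap_zero_apply]

lemma ext_exact₃ (h : IsShortExact f g) (X : ModuleCat.{u} R) (i : ℕ) :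
    Function.Exact (extMap X g i) (h.extδ X i) := by
  refine fun x => ⟨fun hx => Ext.covariant_sequence_exact₃ X h.shortExact x rfl hx, ?_⟩
  rintro ⟨y, rfl⟩
  rw [extδ_apply, extMap_apply, Ext.comp_assoc (a₁₂ := i) (a₂₃ := 1) (a := i + 1) _ _ _
    (by omega)
    (by omega) (by omega), h.shortExact.comp_extClass, Ext.comp_zero]

lemma ext_exact₁ (h : IsShortExact f g) (X : ModuleCat.{u} R) (i : ℕ) :
    Function.Exact (h.extδ X i) (extMap X f (i + 1)) := by
  refine fun x => ⟨fun hx => Ext.covariant_sequence_exact₁ X h.shortExact x hx rfl, ?_⟩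
  rintro ⟨y, rfl⟩
  rw [extδ_apply, extMap_apply, Ext.comp_assoc (a₁₂ := i + 1) (a₂₃ := 1) (a := i + 1) _ _ _ (by omega)
    (by omega) (by omega), h.shortExact.extClass_comp, Ext.comp_zero]

lemma extMap_zero_injective (h : IsShortExact f g) (X : ModuleCat.{u} R) :
    Function.Injective (extMap X f 0) := by
  have : Mono (ModuleCat.ofHom f) := (ModuleCat.mono_iff_injective _).2 h.inj
  exact Ext.postcomp_mk₀_injective_of_mono X (ModuleCat.ofHom f)

end IsShortExact

end ExtFinite

section Criterion

open Abelian

variable {R : Type u} [CommRing R]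

lemma IsPowTorsion.of_injective {R : Type*} [CommRing R] {𝔞 : Ideal R} {N N' : Type*}
    [AddCommGroup N] [Module R N] [AddCommGroup N'] [Module R N'] (h : IsPowTorsion 𝔞 N')
    (f : N →ₗ[R] N') (hf : Function.Injective f) : IsPowTorsion 𝔞 N := fun m => by
  obtain ⟨n, hn⟩ := h (f m)
  exact ⟨n, fun r hr => hf (by rw [map_smul, hn r hr, map_zero])⟩

lemma IsPowTorsion.of_surjective {R : Type*} [CommRing R] {𝔞 : Ideal R} {N N' : Type*}
    [AddCommGroup N] [Module R N] [AddCommGroup N'] [Module R N'] (h : IsPowTorsion 𝔞 N)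
    (f : N →ₗ[R] N') (hf : Function.Surjective f) : IsPowTorsion 𝔞 N' := fun m => by
  obtain ⟨m, rfl⟩ := hf m
  obtain ⟨n, hn⟩ := h m
  exact ⟨n, fun r hr => by rw [← map_smul, hn r hr, map_zero]⟩

/-- `Ext^i(R ⧸ 𝔞, N)` is finitely generated. -/
def ExtFin (𝔞 : Ideal R) (N : Type u) [AddCommGroup N] [Module R N] (i : ℕ) : Prop :=
  Module.Finite R (Abelian.Ext (ModuleCat.of R (R ⧸ 𝔞)) (ModuleCat.of R N) i)

variable {𝔞 : Ideal R} {N N₁ N₂ N₃ : Type u} [AddCommGroup N] [Module R N] [AddCommGroup N₁]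
  [Module R N₁] [AddCommGroup N₂] [Module R N₂] [AddCommGroup N₃] [Module R N₃]

lemma extFin_of_linearEquiv (e : N₁ ≃ₗ[R] N₂) {i : ℕ} (h : ExtFin 𝔞 N₁ i) : ExtFin 𝔞 N₂ i := by
  have : Module.Finite R (Abelian.Ext (ModuleCat.of R (R ⧸ 𝔞)) (ModuleCat.of R N₁) i) := h
  refine Module.Finite.of_surjective (extMap _ e.toLinearMap i) fun x =>
    ⟨extMap _ e.symm.toLinearMap i x, ?_⟩
  rw [← extMap_comp_apply, LinearEquiv.comp_symm, extMap_id_apply]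

lemma extFin_of_finite [IsNoetherianRing R] [Module.Finite R N] (i : ℕ) : ExtFin 𝔞 N i :=
  ModuleCat.finite_ext R (ModuleCat.of R (R ⧸ 𝔞)) (ModuleCat.of R N) i

lemma extFin_zero_iff :
    ExtFin 𝔞 N 0 ↔ Module.Finite R (Submodule.torsionBySet R N (𝔞 : Set R)) := by
  let e₁ : Abelian.Ext (ModuleCat.of R (R ⧸ 𝔞)) (ModuleCat.of R N) 0 ≃ₗ[R] ((R ⧸ 𝔞) →ₗ[R] N) :=
    Ext.linearEquiv₀.trans ModuleCat.homLinearEquiv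
  let e₂ : ((R ⧸ 𝔞) →ₗ[R] N) ≃ₗ[R] Submodule.torsionBySet R N (𝔞 : Set R) := by
    refine LinearEquiv.ofBijective (LinearMap.codRestrict _ (LinearMap.applyₗ (1 : R ⧸ 𝔞)) ?_)
      ⟨?_, ?_⟩
    · refine fun φ => mem_torsionBySet_ideal.2 fun r hr => ?_
      rw [LinearMap.applyₗ_apply_apply, ← map_smul]
      have : r • (1 : R ⧸ 𝔞) = 0 := by
        rw [Algebra.smul_def, mul_one]
        exact Ideal.Quotient.eq_zero_iff_mem.2 hr
      rw [this, map_zero]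
    · intro φ ψ h
      have h1 : φ 1 = ψ 1 := congrArg Subtype.val h
      refine LinearMap.ext fun x => ?_
      obtain ⟨r, rfl⟩ := Ideal.Quotient.mk_surjective x
      have : Ideal.Quotient.mk 𝔞 r = r • (1 : R ⧸ 𝔞) := by rw [Algebra.smul_def, mul_one]; rfl
      rw [this, map_smul, map_smul, h1]
    · rintro ⟨m, hm⟩
      refine ⟨Submodule.liftQ 𝔞 (LinearMap.toSpanSingleton R N m) fun r hr =>
        mem_torsionBySet_ideal.1 hm r hr, Subtype.ext ?_⟩
      change (1 : R) • m = m
      exact one_smul R m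
  exact Module.Finite.equiv_iff (e₁.trans e₂)

lemma extFin_of_pow_smul_eq_zero [IsNoetherianRing R] (n : ℕ)
    (h : ∀ r ∈ 𝔞 ^ n, ∀ m : N, r • m = 0) (h0 : ExtFin 𝔞 N 0) (i : ℕ) : ExtFin 𝔞 N i := by
  have := finite_of_pow_smul_eq_zero n h (extFin_zero_iff.1 h0)
  exact extFin_of_finite i

namespace IsShortExact

variable {f : N₁ →ₗ[R] N₂} {g : N₂ →ₗ[R] N₃}

lemma extFin_middle [IsNoetherianRing R] (h : IsShortExact f g) {i : ℕ} (h₁ : ExtFin 𝔞 N₁ i)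
    (h₃ : ExtFin 𝔞 N₃ i) : ExtFin 𝔞 N₂ i :=
  Module.Finite.of_exact_of_isNoetherianRing (h.ext_exact₂ _ i) h₁ h₃

lemma extFin_right [IsNoetherianRing R] (h : IsShortExact f g) {i : ℕ} (h₂ : ExtFin 𝔞 N₂ i)
    (h₁ : ExtFin 𝔞 N₁ (i + 1)) : ExtFin 𝔞 N₃ i :=
  Module.Finite.of_exact_of_isNoetherianRing (h.ext_exact₃ _ i) h₂ h₁

lemma extFin_left [IsNoetherianRing R] (h : IsShortExact f g) {i : ℕ} (h₃ : ExtFin 𝔞 N₃ i)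
    (h₂ : ExtFin 𝔞 N₂ (i + 1)) : ExtFin 𝔞 N₁ (i + 1) :=
  Module.Finite.of_exact_of_isNoetherianRing (h.ext_exact₁ _ i) h₃ h₂

lemma extFin_left_zero [IsNoetherianRing R] (h : IsShortExact f g) (h₂ : ExtFin 𝔞 N₂ 0) :
    ExtFin 𝔞 N₁ 0 := by
  have : Module.Finite R (Abelian.Ext (ModuleCat.of R (R ⧸ 𝔞)) (ModuleCat.of R N₂) 0) := h₂
  exact Module.Finite.of_injective _ (h.extMap_zero_injective (ModuleCat.of R (R ⧸ 𝔞)))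

end IsShortExact

lemma sup_span_singleton_smul_eq_zero {J : Ideal R} {x : R} (hJ : ∀ r ∈ J, ∀ m : N, r • m = 0)
    (hx : ∀ m : N, x • m = 0) : ∀ r ∈ J ⊔ Ideal.span {x}, ∀ m : N, r • m = 0 := by
  have hle : J ⊔ Ideal.span {x} ≤ Module.annihilator R N :=
    sup_le (fun r hr => Module.mem_annihilator.2 (hJ r hr))
      ((Ideal.span_singleton_le_iff_mem _).2 (Module.mem_annihilator.2 hx))
  exact fun r hr => Module.mem_annihilator.1 (hle hr)

lemma lt_sup_span_singleton {J : Ideal R} {x : R} (hx : x ∉ J) : J < J ⊔ Ideal.span {x} :=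
  lt_of_le_of_ne le_sup_left fun h =>
    hx (h ▸ (le_sup_right : Ideal.span {x} ≤ _) (Ideal.mem_span_singleton_self x))

theorem extFin_of_isArtinian [IsNoetherianRing R] (J : Ideal R) (W : Type u) [AddCommGroup W]
    [Module R W] [IsArtinian R W] (hJ : ∀ r ∈ J, ∀ m : W, r • m = 0) (h0 : ExtFin 𝔞 W 0) (i : ℕ) :
    ExtFin 𝔞 W i := by
  induction J using IsNoetherian.induction generalizing W i with
  | hgt J ih =>
  obtain ⟨n, x, hx, hdiv⟩ := exists_pow_smul_top_divisible 𝔞 W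
  let W' := 𝔞 ^ n • (⊤ : Submodule R W)
  by_cases hxJ : x ∈ J
  · refine extFin_of_pow_smul_eq_zero n (fun r hr m => ?_) h0 i
    obtain ⟨w', -, hw'⟩ := hdiv _ (Submodule.smul_mem_smul hr (Submodule.mem_top (x := m)))
    rw [← hw', hJ x hxJ]
  have hmul : Function.Surjective (LinearMap.lsmul R W' x) := by
    rintro ⟨w, hw⟩
    obtain ⟨w', hw', h⟩ := hdiv w hw
    exact ⟨⟨w', hw'⟩, Subtype.ext h⟩
  have hs := isShortExact_ker_of_surjective _ hmul
  have ht := isShortExact_subtype_mkQ W'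
  have hW'0 := ht.extFin_left_zero h0
  have hK : ∀ i, ExtFin 𝔞 (LinearMap.ker (LinearMap.lsmul R W' x)) i := fun i =>
    ih _ (lt_sup_span_singleton hxJ) _ (sup_span_singleton_smul_eq_zero
      (fun r hr m => Subtype.ext (Subtype.ext (hJ r hr _))) fun m => Subtype.ext m.2)
      (hs.extFin_left_zero hW'0) i
  have hW' : ∀ i, ExtFin 𝔞 W' i := fun i => by
    have : Module.Finite R _ := hK (i + 1)
    refine Module.Finite.of_injective (hs.extδ (ModuleCat.of R (R ⧸ 𝔞)) i) ?_
    rw [injective_iff_map_eq_zero]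
    intro y hy
    obtain ⟨z, rfl⟩ := (hs.ext_exact₃ _ i y).1 hy
    rw [extMap_lsmul_apply, smul_ext_eq_zero hx]
  refine ht.extFin_middle (hW' i) (extFin_of_pow_smul_eq_zero n (fun r hr m => ?_)
    (ht.extFin_right h0 (hW' 1)) i)
  obtain ⟨m, rfl⟩ := W'.mkQ_surjective m
  rw [← map_smul, Submodule.mkQ_apply, Submodule.Quotient.mk_eq_zero]
  exact Submodule.smul_mem_smul hr Submodule.mem_top

lemma IsPowTorsion.extFin_of_exists_fg [IsNoetherianRing R] {S : Submonoid R}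
    (hS : ∀ p : Ideal R, p.IsPrime → 𝔞 ≤ p → ∀ s ∈ S, s ∈ p → p.IsMaximal)
    (hN : IsPowTorsion 𝔞 N) (h0 : ExtFin 𝔞 N 0) {P : Submodule R N} (hP : P.FG)
    (hPS : ∀ w : N, ∃ s ∈ S, s • w ∈ P) (i : ℕ) : ExtFin 𝔞 N i := by
  have ht := isShortExact_subtype_mkQ P
  have : Module.Finite R P := Module.Finite.iff_fg.2 hP
  have hQ0 : ExtFin 𝔞 (N ⧸ P) 0 := ht.extFin_right h0 (extFin_of_finite 1)
  have : IsArtinian R (N ⧸ P) := by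
    refine (hN.of_surjective _ P.mkQ_surjective).isArtinian_of_finite_torsionBySet hS (fun w => ?_)
      (extFin_zero_iff.1 hQ0)
    obtain ⟨w, rfl⟩ := P.mkQ_surjective w
    obtain ⟨s, hs, hsw⟩ := hPS w
    refine ⟨s, hs, ?_⟩
    rwa [← map_smul, Submodule.mkQ_apply, Submodule.Quotient.mk_eq_zero]
  exact ht.extFin_middle (extFin_of_finite i) (extFin_of_isArtinian ⊥ _ (by simp) hQ0 i)

/-- If `dim R ⧸ 𝔞 = 1`, cofiniteness of an `𝔞`-torsion module is detected in degrees `0`, `1`. -/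
theorem IsPowTorsion.extFin_of_zero_one [IsNoetherianRing R] (hdim : ringKrullDim (R ⧸ 𝔞) = 1)
    (hN : IsPowTorsion 𝔞 N) (h0 : ExtFin 𝔞 N 0) (h1 : ExtFin 𝔞 N 1) (i : ℕ) : ExtFin 𝔞 N i := by
  obtain ⟨S, hS, hS'⟩ := exists_submonoid_of_ringKrullDim_quotient_eq_one hdim
  suffices ∀ J : Ideal R, ∀ (N : Type u) [AddCommGroup N] [Module R N], IsPowTorsion 𝔞 N →
      ExtFin 𝔞 N 0 → ExtFin 𝔞 N 1 → (∀ r ∈ J, ∀ m : N, r • m = 0) → ∀ i, ExtFin 𝔞 N i from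
    this ⊥ N hN h0 h1 (by simp) i
  clear hN h0 h1 i
  intro J
  induction J using IsNoetherian.induction with
  | hgt J ih =>
  intro N _ _ hN h0 h1 hJ i
  obtain ⟨x, hx, P, hP, hdiv⟩ := hN.exists_localized_finite_quotient hS (extFin_zero_iff.1 h0)
  by_cases hxJ : x ∈ J
  · refine hN.extFin_of_exists_fg hS' h0 hP (fun w => ?_) i
    obtain ⟨s, hs, p, hp, w', h⟩ := hdiv w
    refine ⟨s, hs, ?_⟩
    rwa [h, hJ x hxJ, add_zero]
  let φ := LinearMap.lsmul R N x
  have hs := isShortExact_ker_rangeRestrict φ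
  have ht := isShortExact_subtype_mkQ (LinearMap.range φ)
  have hI0 := ht.extFin_left_zero h0
  have hK : ∀ i, ExtFin 𝔞 (LinearMap.ker φ) i :=
    ih _ (lt_sup_span_singleton hxJ) _ (hN.of_injective _ hs.inj) (hs.extFin_left_zero h0)
      (hs.extFin_left hI0 h1) (sup_span_singleton_smul_eq_zero
        (fun r hr m => Subtype.ext (hJ r hr _)) fun m => Subtype.ext m.2)
  have hL0 := ht.extFin_right h0 (hs.extFin_right h1 (hK 2))
  have hL : ∀ i, ExtFin 𝔞 (N ⧸ LinearMap.range φ) i := by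
    refine (hN.of_surjective _ ht.surj).extFin_of_exists_fg hS' hL0 (hP.map (Submodule.mkQ _)) ?_
    intro w
    obtain ⟨w, rfl⟩ := Submodule.mkQ_surjective _ w
    obtain ⟨s, hs, p, hp, w', h⟩ := hdiv w
    refine ⟨s, hs, p, hp, ?_⟩
    rw [← map_smul, h, map_add, eq_comm, add_eq_left, Submodule.mkQ_apply,
      Submodule.Quotient.mk_eq_zero]
    exact ⟨w', rfl⟩
  rcases i with _ | i
  · exact h0
  let X := ModuleCat.of R (R ⧸ 𝔞)
  have : Module.Finite R _ := hL i
  have hfin : Module.Finite R (LinearMap.range (extMap X φ.rangeRestrict (i + 1))) := by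
    have hle : LinearMap.range (extMap X φ.rangeRestrict (i + 1)) ≤
        LinearMap.range (ht.extδ X i) := by
      rintro _ ⟨y, rfl⟩
      refine (ht.ext_exact₁ X i _).1 ?_
      rw [← extMap_comp_apply]
      exact (extMap_lsmul_apply X x (i + 1) y).trans (smul_ext_eq_zero hx _ y)
    exact Module.Finite.of_injective _ (Submodule.inclusion_injective hle)
  have : Module.Finite R _ := hK (i + 1)
  refine Module.Finite.of_exact (f := extMap X (LinearMap.ker φ).subtype (i + 1))
    (g := (extMap X φ.rangeRestrict (i + 1)).rangeRestrict) ?_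
    (LinearMap.surjective_rangeRestrict _)
  rw [LinearMap.exact_iff, LinearMap.ker_rangeRestrict, (hs.ext_exact₂ X (i + 1)).linearMap_ker_eq]

end Criterion

section TorsionInjective

variable {R : Type u} [CommRing R]

/-- The submodule of elements killed by a power of `𝔞`. -/
def powTorsion (𝔞 : Ideal R) (M : Type*) [AddCommGroup M] [Module R M] : Submodule R M where
  carrier := {m | ∃ n : ℕ, ∀ r ∈ 𝔞 ^ n, r • m = 0}
  zero_mem' := ⟨0, fun r _ => smul_zero r⟩
  add_mem' := by
    rintro x y ⟨n, hn⟩ ⟨m, hm⟩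
    refine ⟨n + m, fun r hr => ?_⟩
    rw [smul_add, hn r (Ideal.pow_le_pow_right (Nat.le_add_right n m) hr),
      hm r (Ideal.pow_le_pow_right (Nat.le_add_left m n) hr), add_zero]
  smul_mem' := by
    rintro c x ⟨n, hn⟩
    exact ⟨n, fun r hr => by rw [smul_comm, hn r hr, smul_zero]⟩

variable {𝔞 : Ideal R}

lemma isPowTorsion_powTorsion (M : Type*) [AddCommGroup M] [Module R M] :
    IsPowTorsion 𝔞 (powTorsion 𝔞 M) := fun m => by
  obtain ⟨n, hn⟩ := m.2
  exact ⟨n, fun r hr => Subtype.ext (hn r hr)⟩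

lemma exists_pow_smul_eq_zero_of_fg {M : Type*} [AddCommGroup M] [Module R M]
    (hM : IsPowTorsion 𝔞 M) {P : Submodule R M} (hP : P.FG) :
    ∃ n : ℕ, ∀ r ∈ 𝔞 ^ n, ∀ m ∈ P, r • m = 0 := by
  induction P, hP using Submodule.fg_induction with
  | singleton x =>
    obtain ⟨n, hn⟩ := hM x
    refine ⟨n, fun r hr m hm => ?_⟩
    obtain ⟨c, rfl⟩ := Submodule.mem_span_singleton.1 hm
    rw [smul_comm, hn r hr, smul_zero]
  | sup P Q hP hQ h₁ h₂ =>
    obtain ⟨n, hn⟩ := h₁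
    obtain ⟨k, hk⟩ := h₂
    refine ⟨n + k, fun r hr m hm => ?_⟩
    obtain ⟨x, hx, y, hy, rfl⟩ := Submodule.mem_sup.1 hm
    rw [smul_add, hn r (Ideal.pow_le_pow_right (Nat.le_add_right n k) hr) x hx,
      hk r (Ideal.pow_le_pow_right (Nat.le_add_left k n) hr) y hy, add_zero]

lemma mem_powTorsion_of_pow_smul_mem [IsNoetherianRing R] {M : Type*} [AddCommGroup M] [Module R M]
    {m : M} (n : ℕ) (h : ∀ r ∈ 𝔞 ^ n, r • m ∈ powTorsion 𝔞 M) : m ∈ powTorsion 𝔞 M := by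
  let f : (𝔞 ^ n : Ideal R) →ₗ[R] powTorsion 𝔞 M :=
    (LinearMap.toSpanSingleton R M m ∘ₗ (𝔞 ^ n).subtype).codRestrict _ fun r => h r r.2
  obtain ⟨k, hk⟩ := exists_pow_smul_eq_zero_of_fg (isPowTorsion_powTorsion (𝔞 := 𝔞) M)
    (P := LinearMap.range f) (Module.Finite.iff_fg.1 inferInstance)
  refine ⟨k + n, fun r hr => ?_⟩
  rw [pow_add] at hr
  refine Submodule.mul_induction_on hr (fun a ha b hb => ?_) fun x y hx hy => ?_
  · rw [mul_smul]
    exact congrArg Subtype.val (hk a ha _ ⟨⟨b, hb⟩, rfl⟩)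
  · rw [add_smul, hx, hy, add_zero]

lemma powTorsion_quotient_eq_bot [IsNoetherianRing R] (M : Type*) [AddCommGroup M] [Module R M] :
    powTorsion 𝔞 (M ⧸ powTorsion 𝔞 M) = ⊥ := by
  refine eq_bot_iff.2 fun m hm => ?_
  obtain ⟨m, rfl⟩ := Submodule.mkQ_surjective _ m
  obtain ⟨n, hn⟩ := hm
  refine (Submodule.mem_bot R).2 ((Submodule.Quotient.mk_eq_zero _).2
    (mem_powTorsion_of_pow_smul_mem n fun r hr => ?_))
  rw [← Submodule.Quotient.mk_eq_zero]
  exact hn r hr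

lemma injective_powTorsion [IsNoetherianRing R] (E : Type u) [AddCommGroup E] [Module R E]
    [Module.Injective R E] : Module.Injective R (powTorsion 𝔞 E) := by
  refine Module.Baer.injective fun I g => ?_
  obtain ⟨n, hn⟩ := exists_pow_smul_eq_zero_of_fg (isPowTorsion_powTorsion (𝔞 := 𝔞) E)
    (P := LinearMap.range g) (Module.Finite.iff_fg.1 inferInstance)
  obtain ⟨k, hk⟩ := Ideal.exists_pow_inf_eq_pow_smul 𝔞 I
  have hle : 𝔞 ^ (n + k) ⊓ I ≤ 𝔞 ^ n * I := by
    have := hk (n + k) (by omega)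
    rw [Nat.add_sub_cancel] at this
    have h2 : (𝔞 ^ (n + k) • ⊤ : Ideal R) ⊓ I ≤ 𝔞 ^ n • I :=
      this.le.trans (Submodule.smul_mono le_rfl inf_le_right)
    simpa using h2
  have hg : 𝔞 ^ n * I ≤ (LinearMap.ker g).map I.subtype :=
    Submodule.mul_le.2 fun a ha b hb =>
      ⟨⟨a * b, I.mul_mem_left a hb⟩, (g.map_smul a ⟨b, hb⟩).trans (hn a ha _ ⟨⟨b, hb⟩, rfl⟩), rfl⟩
  let q : I →ₗ[R] R ⧸ 𝔞 ^ (n + k) := Submodule.mkQ (𝔞 ^ (n + k)) ∘ₗ I.subtype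
  let g' : I ⧸ LinearMap.ker q →ₗ[R] powTorsion 𝔞 E := (LinearMap.ker q).liftQ g fun x hx => by
    obtain ⟨y, hy, hyx⟩ := hg (hle ⟨(Submodule.Quotient.mk_eq_zero _).1 hx, x.2⟩)
    rwa [Subtype.ext hyx] at hy
  let q' : I ⧸ LinearMap.ker q →ₗ[R] R ⧸ 𝔞 ^ (n + k) := (LinearMap.ker q).liftQ q le_rfl
  have hq' : Function.Injective q' :=
    LinearMap.ker_eq_bot.1 (Submodule.ker_liftQ_eq_bot _ _ _ le_rfl)
  obtain ⟨h, hh⟩ := Module.Injective.out q' hq' ((powTorsion 𝔞 E).subtype ∘ₗ g')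
  refine ⟨(h ∘ₗ Submodule.mkQ (𝔞 ^ (n + k))).codRestrict _ fun x => ⟨n + k, fun r hr => ?_⟩,
    fun x hx => Subtype.ext (hh (Submodule.Quotient.mk ⟨x, hx⟩))⟩
  rw [← map_smul, LinearMap.comp_apply, Submodule.mkQ_apply,
    (Submodule.Quotient.mk_eq_zero _ (x := r • x)).2 (Ideal.mul_mem_right _ _ hr), map_zero]

lemma exists_injective_embedding (N : Type u) [AddCommGroup N] [Module R N] :
    ∃ (E : Type u) (_ : AddCommGroup E) (_ : Module R E) (f : N →ₗ[R] E),
      Module.Injective R E ∧ Function.Injective f := by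
  let E := Injective.under (ModuleCat.of R N)
  refine ⟨E, inferInstance, inferInstance, (Injective.ι (ModuleCat.of R N)).hom, ?_, ?_⟩
  · have : Injective (ModuleCat.of R E) := inferInstanceAs (Injective E)
    exact Module.injective_module_of_injective_object R E
  · exact (ModuleCat.mono_iff_injective _).1 inferInstance

lemma IsPowTorsion.exists_injective_embedding [IsNoetherianRing R] {N : Type u} [AddCommGroup N]
    [Module R N] (hN : IsPowTorsion 𝔞 N) :
    ∃ (E : Type u) (_ : AddCommGroup E) (_ : Module R E) (f : N →ₗ[R] E),
      Module.Injective R E ∧ IsPowTorsion 𝔞 E ∧ Function.Injective f := by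
  obtain ⟨E, _, _, f, hE, hf⟩ := _root_.exists_injective_embedding (R := R) N
  refine ⟨powTorsion 𝔞 E, inferInstance, inferInstance, f.codRestrict _ fun m => ?_,
    injective_powTorsion E, isPowTorsion_powTorsion E, ?_⟩
  · obtain ⟨n, hn⟩ := hN m
    exact ⟨n, fun r hr => by rw [← map_smul, hn r hr, map_zero]⟩
  · exact fun x y h => hf (congrArg Subtype.val h)

lemma exists_torsionFree_injective_embedding [IsNoetherianRing R] {N : Type u} [AddCommGroup N]
    [Module R N] (hN : powTorsion 𝔞 N = ⊥) :
    ∃ (E : Type u) (_ : AddCommGroup E) (_ : Module R E) (f : N →ₗ[R] E),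
      Module.Injective R E ∧ powTorsion 𝔞 E = ⊥ ∧ Function.Injective f := by
  obtain ⟨E, _, _, f, hE, hf⟩ := exists_injective_embedding (R := R) N
  have hT := injective_powTorsion (𝔞 := 𝔞) E
  obtain ⟨ρ, hρ⟩ := Module.Injective.out (powTorsion 𝔞 E).subtype
    (Submodule.injective_subtype _) (LinearMap.id (R := R) (M := powTorsion 𝔞 E))
  refine ⟨E ⧸ powTorsion 𝔞 E, inferInstance, inferInstance, (powTorsion 𝔞 E).mkQ ∘ₗ f, ?_,
    powTorsion_quotient_eq_bot E, ?_⟩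
  · let s : (E ⧸ powTorsion 𝔞 E) →ₗ[R] E := (powTorsion 𝔞 E).liftQ
      (LinearMap.id - (powTorsion 𝔞 E).subtype ∘ₗ ρ) fun x hx => by
        have := congrArg Subtype.val (hρ ⟨x, hx⟩)
        simpa [sub_eq_zero] using this.symm
    have hs : ∀ y, (powTorsion 𝔞 E).mkQ (s y) = y := by
      intro y
      obtain ⟨x, rfl⟩ := Submodule.mkQ_surjective _ y
      change Submodule.Quotient.mk (x - (ρ x : E)) = Submodule.Quotient.mk x
      rw [Submodule.Quotient.mk_sub, (Submodule.Quotient.mk_eq_zero _).2 (ρ x).2, sub_zero]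
    refine ⟨fun X Y _ _ _ _ i hi g => ?_⟩
    obtain ⟨h, hh⟩ := Module.Injective.out i hi (s ∘ₗ g)
    exact ⟨(powTorsion 𝔞 E).mkQ ∘ₗ h, fun x => by
      rw [LinearMap.comp_apply, hh, LinearMap.comp_apply, hs]⟩
  · rw [← LinearMap.ker_eq_bot, eq_bot_iff]
    intro x hx
    obtain ⟨n, hn⟩ := (Submodule.Quotient.mk_eq_zero _).1 (LinearMap.mem_ker.1 hx)
    rw [← hN]
    exact ⟨n, fun r hr => hf (by rw [map_smul, hn r hr, map_zero])⟩

end TorsionInjective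

section LocalCohomologyLimit

open Abelian

variable {R : Type u} [CommRing R] (𝔞 : Ideal R)

/-- The module `R ⧸ 𝔞 ^ n`. -/
abbrev quotPow (n : ℕ) : ModuleCat.{u} R := ModuleCat.of R (R ⧸ 𝔞 ^ n)

/-- The projection `R ⧸ 𝔞 ^ m → R ⧸ 𝔞 ^ n` for `n ≤ m`. -/
def quotPowMap {n m : ℕ} (h : n ≤ m) : quotPow 𝔞 m ⟶ quotPow 𝔞 n :=
  ModuleCat.ofHom (Submodule.mapQ _ _ LinearMap.id (Ideal.pow_le_pow_right h))

lemma quotPowMap_comp {n m k : ℕ} (h : n ≤ m) (h' : m ≤ k) :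
    quotPowMap 𝔞 h' ≫ quotPowMap 𝔞 h = quotPowMap 𝔞 (h.trans h') := by
  refine ModuleCat.hom_ext (LinearMap.ext fun x => ?_)
  obtain ⟨x, rfl⟩ := Submodule.mkQ_surjective _ x
  rfl

variable {𝔞}

/-- The map `Ext^i(R ⧸ 𝔞 ^ n, Y) → Ext^i(R ⧸ 𝔞 ^ m, Y)` for `n ≤ m`. -/
noncomputable def extRes {n m : ℕ} (h : n ≤ m) (Y : ModuleCat.{u} R) (i : ℕ) :
    Abelian.Ext (quotPow 𝔞 n) Y i →ₗ[R] Abelian.Ext (quotPow 𝔞 m) Y i :=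
  (Ext.mk₀ (quotPowMap 𝔞 h)).precompOfLinear R Y (zero_add i)

lemma extRes_apply {n m : ℕ} (h : n ≤ m) (Y : ModuleCat.{u} R) (i : ℕ)
    (x : Abelian.Ext (quotPow 𝔞 n) Y i) :
    extRes h Y i x = (Ext.mk₀ (quotPowMap 𝔞 h)).comp x (zero_add i) := rfl

lemma extRes_extRes {n m k : ℕ} (h : n ≤ m) (h' : m ≤ k) (Y : ModuleCat.{u} R) (i : ℕ)
    (x : Abelian.Ext (quotPow 𝔞 n) Y i) :
    extRes h' Y i (extRes h Y i x) = extRes (h.trans h') Y i x := by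
  rw [extRes_apply, extRes_apply, extRes_apply, Ext.mk₀_comp_mk₀_assoc, quotPowMap_comp]

variable {N N₁ N₂ N₃ : Type u} [AddCommGroup N] [Module R N] [AddCommGroup N₁]
  [Module R N₁] [AddCommGroup N₂] [Module R N₂] [AddCommGroup N₃] [Module R N₃]

lemma extRes_extMap {n m : ℕ} (h : n ≤ m) (f : N₁ →ₗ[R] N₂) (i : ℕ)
    (x : Abelian.Ext (quotPow 𝔞 n) (ModuleCat.of R N₁) i) :
    extRes h _ i (extMap _ f i x) = extMap _ f i (extRes h _ i x) := by
  rw [extRes_apply, extMap_apply, extMap_apply, extRes_apply,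
    Ext.comp_assoc (a₁₂ := i) (a₂₃ := i) (a := i) _ _ _ (by omega) (by omega) (by omega)]

lemma IsShortExact.extRes_extδ {f : N₁ →ₗ[R] N₂} {g : N₂ →ₗ[R] N₃} (hs : IsShortExact f g)
    {n m : ℕ} (h : n ≤ m) (i : ℕ) (x : Abelian.Ext (quotPow 𝔞 n) (ModuleCat.of R N₃) i) :
    extRes h _ (i + 1) (hs.extδ _ i x) = hs.extδ _ i (extRes h _ i x) := by
  rw [extRes_apply, hs.extδ_apply, hs.extδ_apply, extRes_apply,
    Ext.comp_assoc (a₁₂ := i) (a₂₃ := i + 1) (a := i + 1) _ _ _ (by omega) (by omega) (by omega)]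

lemma ext_eq_zero_of_injective [Module.Injective R N] (X : ModuleCat.{u} R) (i : ℕ)
    (x : Abelian.Ext X (ModuleCat.of R N) (i + 1)) : x = 0 := by
  have : Injective (ModuleCat.of R N) := Module.injective_object_of_injective_module R N
  exact Ext.eq_zero_of_injective x

/-- Evaluation at `1` of a homomorphism `R ⧸ 𝔞 ^ n → N`. -/
noncomputable def evalOne (n : ℕ) (N : Type u) [AddCommGroup N] [Module R N] :
    Abelian.Ext (quotPow 𝔞 n) (ModuleCat.of R N) 0 →ₗ[R] N :=
  let e : Abelian.Ext (quotPow 𝔞 n) (ModuleCat.of R N) 0 ≃ₗ[R] ((R ⧸ 𝔞 ^ n) →ₗ[R] N) :=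
    Ext.linearEquiv₀.trans ModuleCat.homLinearEquiv
  LinearMap.applyₗ (1 : R ⧸ 𝔞 ^ n) ∘ₗ e.toLinearMap

lemma evalOne_mk₀ (n : ℕ) (φ : quotPow 𝔞 n ⟶ ModuleCat.of R N) :
    evalOne n N (Ext.mk₀ φ) = φ.hom (1 : R ⧸ 𝔞 ^ n) := by
  have : Ext.linearEquiv₀ (R := R) (Ext.mk₀ φ) = φ :=
    Ext.linearEquiv₀.symm.injective (Ext.linearEquiv₀.symm_apply_apply _)
  change (Ext.linearEquiv₀ (R := R) (Ext.mk₀ φ)).hom (1 : R ⧸ 𝔞 ^ n) = _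
  rw [this]

lemma evalOne_extMap (n : ℕ) (f : N₁ →ₗ[R] N₂)
    (x : Abelian.Ext (quotPow 𝔞 n) (ModuleCat.of R N₁) 0) :
    evalOne n N₂ (extMap _ f 0 x) = f (evalOne n N₁ x) := by
  obtain ⟨φ, rfl⟩ := (Ext.mk₀_bijective _ _).2 x
  rw [extMap_apply, Ext.mk₀_comp_mk₀, evalOne_mk₀, evalOne_mk₀]
  rfl

lemma evalOne_extRes {n m : ℕ} (h : n ≤ m) (x : Abelian.Ext (quotPow 𝔞 n) (ModuleCat.of R N) 0) :
    evalOne m N (extRes h _ 0 x) = evalOne n N x := by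
  obtain ⟨φ, rfl⟩ := (Ext.mk₀_bijective _ _).2 x
  rw [extRes_apply, Ext.mk₀_comp_mk₀, evalOne_mk₀, evalOne_mk₀]
  rfl

lemma evalOne_injective (n : ℕ) : Function.Injective (evalOne (𝔞 := 𝔞) n N) := by
  intro x y hxy
  obtain ⟨φ, rfl⟩ := (Ext.mk₀_bijective _ _).2 x
  obtain ⟨ψ, rfl⟩ := (Ext.mk₀_bijective _ _).2 y
  rw [evalOne_mk₀, evalOne_mk₀] at hxy
  congr 1
  refine ModuleCat.hom_ext (LinearMap.ext fun x => ?_)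
  obtain ⟨r, rfl⟩ := Ideal.Quotient.mk_surjective x
  have : Ideal.Quotient.mk (𝔞 ^ n) r = r • (1 : R ⧸ 𝔞 ^ n) := by
    rw [Algebra.smul_def, mul_one]; rfl
  rw [this]
  exact (φ.hom.map_smul r _).trans ((congrArg _ hxy).trans (ψ.hom.map_smul r _).symm)

lemma smul_evalOne_eq_zero (n : ℕ) (x : Abelian.Ext (quotPow 𝔞 n) (ModuleCat.of R N) 0) :
    ∀ r ∈ 𝔞 ^ n, r • evalOne n N x = 0 := by
  intro r hr
  rw [← map_smul, smul_ext_eq_zero hr, map_zero]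

lemma exists_evalOne_eq {n : ℕ} {m : N} (hm : ∀ r ∈ 𝔞 ^ n, r • m = 0) :
    ∃ x : Abelian.Ext (quotPow 𝔞 n) (ModuleCat.of R N) 0, evalOne n N x = m := by
  refine ⟨Ext.mk₀ (ModuleCat.ofHom
    (Submodule.liftQ (𝔞 ^ n) (LinearMap.toSpanSingleton R N m) hm)), ?_⟩
  rw [evalOne_mk₀]
  exact one_smul R m

theorem IsPowTorsion.exists_extRes_eq_zero [IsNoetherianRing R] (hN : IsPowTorsion 𝔞 N) (i n : ℕ)
    (x : Abelian.Ext (quotPow 𝔞 n) (ModuleCat.of R N) (i + 1)) :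
    ∃ (m : ℕ) (h : n ≤ m), extRes h _ (i + 1) x = 0 := by
  induction i generalizing N with
  | zero =>
    obtain ⟨E, _, _, f, hE, hEt, hf⟩ := hN.exists_injective_embedding
    have hs : IsShortExact f (LinearMap.range f).mkQ :=
      ⟨hf, LinearMap.exact_map_mkQ_range f, Submodule.mkQ_surjective _⟩
    obtain ⟨y, rfl⟩ := (hs.ext_exact₁ _ 0 x).1 (ext_eq_zero_of_injective _ 0 _)
    obtain ⟨e, he⟩ := Submodule.mkQ_surjective _ (evalOne n _ y)
    obtain ⟨k, hk⟩ := hEt e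
    obtain ⟨z, hz⟩ := exists_evalOne_eq (n := n + k) (m := e) fun r hr =>
      hk r (Ideal.pow_le_pow_right (Nat.le_add_left k n) hr)
    refine ⟨n + k, Nat.le_add_right n k, ?_⟩
    have : extRes (Nat.le_add_right n k) _ 0 y = extMap _ (LinearMap.range f).mkQ 0 z :=
      evalOne_injective _ (by rw [evalOne_extRes, evalOne_extMap, hz, he])
    rw [hs.extRes_extδ, this]
    exact (hs.ext_exact₃ _ 0 _).2 ⟨z, rfl⟩
  | succ i ih =>
    obtain ⟨E, _, _, f, hE, hEt, hf⟩ := hN.exists_injective_embedding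
    have hs : IsShortExact f (LinearMap.range f).mkQ :=
      ⟨hf, LinearMap.exact_map_mkQ_range f, Submodule.mkQ_surjective _⟩
    obtain ⟨y, rfl⟩ := (hs.ext_exact₁ _ (i + 1) x).1 (ext_eq_zero_of_injective _ (i + 1) _)
    obtain ⟨m, h, hm⟩ := ih (hEt.of_surjective _ (Submodule.mkQ_surjective _)) y
    exact ⟨m, h, by rw [hs.extRes_extδ, hm, map_zero]⟩

variable (𝔞) in
/-- The module `D` is a direct limit of the modules `Ext^t(R ⧸ 𝔞 ^ n, M)`. -/
def IsExtLimit (t : ℕ) (M D : Type u) [AddCommGroup M] [Module R M] [AddCommGroup D]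
    [Module R D] : Prop :=
  ∃ ψ : ∀ n, Abelian.Ext (quotPow 𝔞 n) (ModuleCat.of R M) t →ₗ[R] D,
    (∀ n m (h : n ≤ m) x, ψ m (extRes h _ t x) = ψ n x) ∧ (∀ d, ∃ n x, ψ n x = d) ∧
      ∀ n x, ψ n x = 0 → ∃ (m : ℕ) (h : n ≤ m), extRes h _ t x = 0

variable {D : Type u} [AddCommGroup D] [Module R D]

lemma isExtLimit_zero (M : Type u) [AddCommGroup M] [Module R M] :
    IsExtLimit 𝔞 0 M (powTorsion 𝔞 M) := by
  refine ⟨fun n => (evalOne n M).codRestrict _ fun x => ⟨n, smul_evalOne_eq_zero n x⟩,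
    fun n m h x => Subtype.ext (evalOne_extRes h x), ?_, fun n x hx => ⟨n, le_rfl, ?_⟩⟩
  · rintro ⟨d, n, hn⟩
    obtain ⟨x, hx⟩ := exists_evalOne_eq hn
    exact ⟨n, x, Subtype.ext hx⟩
  · rw [(evalOne_injective n) ((congrArg Subtype.val hx).trans (map_zero (evalOne n M)).symm),
      map_zero]

lemma IsExtLimit.of_compatible {s t : ℕ} (hD : IsExtLimit 𝔞 s N₂ D)
    (θ : ∀ n, Abelian.Ext (quotPow 𝔞 n) (ModuleCat.of R N₁) t →ₗ[R]
      Abelian.Ext (quotPow 𝔞 n) (ModuleCat.of R N₂) s)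
    (hθ : ∀ n m (h : n ≤ m) x, θ m (extRes h _ t x) = extRes h _ s (θ n x))
    (hsurj : ∀ n y, ∃ (m : ℕ) (h : n ≤ m) (x : _), θ m x = extRes h _ s y)
    (hinj : ∀ n x, θ n x = 0 → ∃ (m : ℕ) (h : n ≤ m), extRes h _ t x = 0) :
    IsExtLimit 𝔞 t N₁ D := by
  obtain ⟨ψ, hψ, hψs, hψi⟩ := hD
  refine ⟨fun n => ψ n ∘ₗ θ n, fun n m h x => ?_, fun d => ?_, fun n x hx => ?_⟩
  · rw [LinearMap.comp_apply, hθ, hψ, LinearMap.comp_apply]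
  · obtain ⟨n, y, rfl⟩ := hψs d
    obtain ⟨m, h, x, hx⟩ := hsurj n y
    exact ⟨m, x, by rw [LinearMap.comp_apply, hx, hψ]⟩
  · obtain ⟨m, h, hm⟩ := hψi n _ hx
    rw [← hθ] at hm
    obtain ⟨k, h', hk⟩ := hinj m _ hm
    exact ⟨k, h.trans h', by rw [← hk, extRes_extRes]⟩

lemma IsExtLimit.of_isPowTorsion [IsNoetherianRing R] {f : N₁ →ₗ[R] N₂} {g : N₂ →ₗ[R] N₃}
    (hs : IsShortExact f g) (hN : IsPowTorsion 𝔞 N₁) {t : ℕ} (hD : IsExtLimit 𝔞 (t + 1) N₃ D) :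
    IsExtLimit 𝔞 (t + 1) N₂ D := by
  refine hD.of_compatible (fun n => extMap _ g (t + 1))
    (fun n m h x => (extRes_extMap h g _ x).symm)
    (fun n y => ?_) fun n x hx => ?_
  · obtain ⟨m, h, hm⟩ := hN.exists_extRes_eq_zero (t + 1) n (hs.extδ _ (t + 1) y)
    rw [hs.extRes_extδ] at hm
    exact ⟨m, h, (hs.ext_exact₃ _ (t + 1) _).1 hm⟩
  · obtain ⟨y, rfl⟩ := (hs.ext_exact₂ _ (t + 1) x).1 hx
    obtain ⟨m, h, hm⟩ := hN.exists_extRes_eq_zero t n y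
    exact ⟨m, h, by rw [extRes_extMap, hm, map_zero]⟩

lemma IsExtLimit.of_injective {f : N₁ →ₗ[R] N₂} {g : N₂ →ₗ[R] N₃} (hs : IsShortExact f g)
    [Module.Injective R N₂] (hN : powTorsion 𝔞 N₂ = ⊥) {t : ℕ} (hD : IsExtLimit 𝔞 t N₃ D) :
    IsExtLimit 𝔞 (t + 1) N₁ D := by
  have h0 : ∀ n (x : Abelian.Ext (quotPow 𝔞 n) (ModuleCat.of R N₂) t), x = 0 := by
    intro n x
    cases t with
    | zero =>
      have : evalOne n N₂ x ∈ powTorsion 𝔞 N₂ := ⟨n, smul_evalOne_eq_zero n x⟩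
      rw [hN, Submodule.mem_bot] at this
      exact evalOne_injective n (this.trans (map_zero _).symm)
    | succ t => exact ext_eq_zero_of_injective _ t x
  have hδ : ∀ n, Function.Bijective (hs.extδ (quotPow 𝔞 n) t) := by
    refine fun n => ⟨(injective_iff_map_eq_zero _).2 fun y hy => ?_, fun x =>
      (hs.ext_exact₁ _ t x).1 (ext_eq_zero_of_injective _ t _)⟩
    obtain ⟨z, rfl⟩ := (hs.ext_exact₃ _ t y).1 hy
    rw [h0 n z, map_zero]
  let e := fun n => LinearEquiv.ofBijective (hs.extδ (quotPow 𝔞 n) t) (hδ n)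
  have he : ∀ n x, hs.extδ (quotPow 𝔞 n) t ((e n).symm x) = x := fun n => (e n).apply_symm_apply
  refine hD.of_compatible (fun n => (e n).symm.toLinearMap) (fun n m h x => ?_) (fun n y => ?_)
    fun n x hx => ⟨n, le_rfl, ?_⟩
  · refine (hδ m).1 ?_
    rw [← hs.extRes_extδ]
    exact (he m _).trans (congrArg _ (he n x).symm)
  · exact ⟨n, le_rfl, e n (extRes le_rfl _ t y), (e n).symm_apply_apply _⟩
  · rw [(e n).symm.map_eq_zero_iff.1 hx, map_zero]

lemma extFin_zero_of_powTorsion_eq_bot (hN : powTorsion 𝔞 N = ⊥) : ExtFin 𝔞 N 0 := by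
  rw [extFin_zero_iff]
  have : Submodule.torsionBySet R N (𝔞 : Set R) = ⊥ := by
    refine eq_bot_iff.2 fun m hm => ?_
    rw [← hN]
    exact ⟨1, fun r hr => mem_torsionBySet_ideal.1 hm r (by rwa [pow_one] at hr)⟩
  rw [this]
  infer_instance

lemma extFin_powTorsion [IsNoetherianRing R] (hdim : ringKrullDim (R ⧸ 𝔞) = 1)
    (hN : ∀ i, ExtFin 𝔞 N i) (i : ℕ) : ExtFin 𝔞 (powTorsion 𝔞 N) i := by
  have hs := isShortExact_subtype_mkQ (powTorsion 𝔞 N)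
  exact (isPowTorsion_powTorsion N).extFin_of_zero_one hdim (hs.extFin_left_zero (hN 0))
    (hs.extFin_left (extFin_zero_of_powTorsion_eq_bot (powTorsion_quotient_eq_bot N)) (hN 1)) i

theorem exists_isExtLimit [IsNoetherianRing R] (hdim : ringKrullDim (R ⧸ 𝔞) = 1) (t : ℕ)
    (M : Type u) [AddCommGroup M] [Module R M] (hM : ∀ i, ExtFin 𝔞 M i) :
    ∃ (D : Type u) (_ : AddCommGroup D) (_ : Module R D),
      IsExtLimit 𝔞 t M D ∧ IsPowTorsion 𝔞 D ∧ ∀ i, ExtFin 𝔞 D i := by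
  induction t generalizing M with
  | zero => exact ⟨_, _, _, isExtLimit_zero M, isPowTorsion_powTorsion M,
    extFin_powTorsion hdim hM⟩
  | succ t ih =>
    have hs := isShortExact_subtype_mkQ (powTorsion 𝔞 M)
    obtain ⟨E, _, _, f, hE, hEt, hf⟩ :=
      exists_torsionFree_injective_embedding (powTorsion_quotient_eq_bot (𝔞 := 𝔞) M)
    have hs' : IsShortExact f (LinearMap.range f).mkQ :=
      ⟨hf, LinearMap.exact_map_mkQ_range f, Submodule.mkQ_surjective _⟩
    have hEfin : ∀ i, ExtFin 𝔞 E i := by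
      rintro (_ | i)
      · exact extFin_zero_of_powTorsion_eq_bot hEt
      · have : Subsingleton (Abelian.Ext (ModuleCat.of R (R ⧸ 𝔞)) (ModuleCat.of R E) (i + 1)) :=
          subsingleton_of_forall_eq 0 (ext_eq_zero_of_injective _ i)
        exact Module.Finite.of_finite
    obtain ⟨D, _, _, hD, hDt, hDfin⟩ := ih (E ⧸ LinearMap.range f) fun i =>
      hs'.extFin_right (hEfin i) (hs.extFin_right (hM (i + 1)) (extFin_powTorsion hdim hM (i + 2)))
    exact ⟨D, _, _, (hD.of_injective hs' hEt).of_isPowTorsion hs (isPowTorsion_powTorsion M),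
      hDt, hDfin⟩

end LocalCohomologyLimit

section ExtComparison

open HomologicalComplex

variable {R : Type u} [CommRing R] {X Z : ModuleCat.{u} R} (P : ProjectiveResolution X)
  (P' : ProjectiveResolution Z)

/-- The map on complexes of linear maps to `Y` induced by a map of complexes. -/
noncomputable def linearYonedaMap {K L : ChainComplex (ModuleCat.{u} R) ℕ} (φ : K ⟶ L)
    (Y : ModuleCat.{u} R) : L.linearYonedaObj R Y ⟶ K.linearYonedaObj R Y :=
  (unopFunctor _ _).map
    ((((linearYoneda R (ModuleCat.{u} R)).obj Y).rightOp.mapHomologicalComplex _).map φ).op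

lemma isoExt_hom_naturality (n : ℕ) (Y : ModuleCat.{u} R) (g : Z ⟶ X)
    (φ : P'.complex ⟶ P.complex) (hφ : φ.f 0 ≫ P.π.f 0 = P'.π.f 0 ≫ g) :
    ((Ext R (ModuleCat.{u} R) n).map g.op).app Y ≫ (P'.isoExt n Y).hom =
      (P.isoExt n Y).hom ≫ homologyMap (linearYonedaMap φ Y) n := by
  have h1 := P'.isoLeftDerivedObj_inv_naturality g P φ hφ
    ((linearYoneda R (ModuleCat.{u} R)).obj Y).rightOp n
  have h2 := (CommSq.mk (homologyOp_hom_naturality (linearYonedaMap φ Y) n)).vert_inv.w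
  exact ((CommSq.mk (congrArg Quiver.Hom.unop h1).symm).horiz_comp
    (CommSq.mk (congrArg Quiver.Hom.unop h2))).w.symm

lemma homologyπ_eq_zero_iff {K : CochainComplex (ModuleCat.{u} R) ℕ} {i n : ℕ}
    (hi : (ComplexShape.up ℕ).prev n = i) (c : K.cycles n) :
    (K.homologyπ n).hom c = 0 ↔ ∃ g : K.X i, (K.d i n).hom g = (K.iCycles n).hom c := by
  have hex := (ShortComplex.moduleCat_exact_iff _).1 (ShortComplex.exact_of_g_is_cokernel
    (ShortComplex.mk _ _ (K.toCycles_comp_homologyπ i n)) (K.homologyIsCokernel i n hi))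
  have hinj : Function.Injective (K.iCycles n).hom :=
    (ModuleCat.mono_iff_injective _).1 inferInstance
  have hd : ∀ g, (K.d i n).hom g = (K.iCycles n).hom ((K.toCycles i n).hom g) := fun g => by
    rw [← LinearMap.comp_apply, ← ModuleCat.hom_comp, K.toCycles_i]
  refine ⟨fun h => ?_, ?_⟩
  · obtain ⟨g, hg⟩ := hex c h
    exact ⟨g, by rw [hd]; exact congrArg _ hg⟩
  · rintro ⟨g, hg⟩
    rw [hd] at hg
    rw [← hinj hg, ← LinearMap.comp_apply, ← ModuleCat.hom_comp, K.toCycles_comp_homologyπ]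
    rfl

lemma exists_iCycles_eq {K : CochainComplex (ModuleCat.{u} R) ℕ} {n : ℕ} (x : K.X n)
    (hx : (K.d n (n + 1)).hom x = 0) : ∃ c, (K.iCycles n).hom c = x := by
  have h : ModuleCat.ofHom (LinearMap.toSpanSingleton R (K.X n) x) ≫ K.d n (n + 1) = 0 :=
    ModuleCat.hom_ext (LinearMap.ext_ring (by simpa using hx))
  refine ⟨(K.liftCycles _ (n + 1) (by simp) h).hom 1, ?_⟩
  rw [← LinearMap.comp_apply, ← ModuleCat.hom_comp, K.liftCycles_i]
  simp

lemma d_iCycles {K : CochainComplex (ModuleCat.{u} R) ℕ} {n : ℕ} (c : K.cycles n) :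
    (K.d n (n + 1)).hom ((K.iCycles n).hom c) = 0 := by
  rw [← LinearMap.comp_apply, ← ModuleCat.hom_comp, K.iCycles_d]
  rfl

lemma extMk_zero_eq_zero_iff {Y : ModuleCat.{u} R} (f : P.complex.X 0 ⟶ Y)
    (hf : P.complex.d 1 0 ≫ f = 0) : P.extMk f 1 rfl hf = 0 ↔ f = 0 := by
  refine ⟨fun h => ?_, ?_⟩
  · rw [← P.extEquivCohomologyClass.apply_eq_iff_eq,
      ProjectiveResolution.extEquivCohomologyClass_extMk,
      ProjectiveResolution.extEquivCohomologyClass_zero,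
      CochainComplex.HomComplex.CohomologyClass.mk_eq_zero_iff,
      CochainComplex.HomComplex.Cocycle.toSingleMk_mem_coboundaries_iff _ _ _ _ _ 1 (by simp)] at h
    obtain ⟨g, hg⟩ := h
    rw [(CochainComplex.isZero_of_isStrictlyLE P.cochainComplex 0 1).eq_of_src g 0,
      Limits.comp_zero] at hg
    rw [← cancel_epi (P.cochainComplexXIso (-0) 0 rfl).hom, Limits.comp_zero]
    exact hg.symm
  · rintro rfl
    exact P.extMk_zero _ _

/-- The linear map underlying a cocycle of the complex of linear maps to `Y`. -/
noncomputable def cocycleHom (K : ChainComplex (ModuleCat.{u} R) ℕ) (Y : ModuleCat.{u} R) (n : ℕ) :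
    (K.linearYonedaObj R Y).cycles n →ₗ[R] (K.X n ⟶ Y) :=
  ((K.linearYonedaObj R Y).iCycles n).hom

lemma d_comp_cocycleHom (K : ChainComplex (ModuleCat.{u} R) ℕ) (Y : ModuleCat.{u} R) (n : ℕ)
    (c : (K.linearYonedaObj R Y).cycles n) : K.d (n + 1) n ≫ cocycleHom K Y n c = 0 :=
  d_iCycles c

lemma exists_cocycleHom_eq (K : ChainComplex (ModuleCat.{u} R) ℕ) {Y : ModuleCat.{u} R} {n : ℕ}
    (f : K.X n ⟶ Y) (hf : K.d (n + 1) n ≫ f = 0) : ∃ c, cocycleHom K Y n c = f :=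
  exists_iCycles_eq (K := K.linearYonedaObj R Y) f hf

lemma cocycleHom_cyclesMap {K L : ChainComplex (ModuleCat.{u} R) ℕ} (φ : K ⟶ L)
    (Y : ModuleCat.{u} R) (n : ℕ) (c : (L.linearYonedaObj R Y).cycles n) :
    cocycleHom K Y n ((cyclesMap (linearYonedaMap φ Y) n).hom c) = φ.f n ≫ cocycleHom L Y n c :=
  congrArg (fun ψ => ψ.hom c) (cyclesMap_i (linearYonedaMap φ Y) n)

lemma extMk_congr {Y : ModuleCat.{u} R} {n : ℕ} {f g : P.complex.X n ⟶ Y} (h : f = g)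
    (hf : P.complex.d (n + 1) n ≫ f = 0) (hg : P.complex.d (n + 1) n ≫ g = 0) :
    P.extMk f (n + 1) rfl hf = P.extMk g (n + 1) rfl hg := by
  subst h
  rfl

/-- The class in `Ext^n(X, Y)` of a cocycle of the complex of linear maps from a projective
resolution of `X` to `Y`. -/
noncomputable def extOfCycles (Y : ModuleCat.{u} R) (n : ℕ) :
    (P.complex.linearYonedaObj R Y).cycles n →ₗ[R] Abelian.Ext X Y n where
  toFun c := P.extMk (cocycleHom P.complex Y n c) (n + 1) rfl (d_comp_cocycleHom _ _ _ c)
  map_add' c c' := by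
    rw [P.add_extMk]
    exact extMk_congr P (map_add _ c c') _ _
  map_smul' r c := by
    have h : ∀ x : Abelian.Ext X Y n,
        r • x = x.comp (Abelian.Ext.mk₀ (r • 𝟙 Y)) (add_zero n) := fun x => by
      rw [Abelian.Ext.mk₀_smul, Abelian.Ext.comp_smul, Abelian.Ext.comp_mk₀_id]
    rw [RingHom.id_apply, h, P.extMk_comp_mk₀]
    refine extMk_congr P ?_ _ _
    rw [Linear.comp_smul, Category.comp_id, map_smul]

lemma extOfCycles_apply (Y : ModuleCat.{u} R) (n : ℕ)
    (c : (P.complex.linearYonedaObj R Y).cycles n) : extOfCycles P Y n c =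
      P.extMk (cocycleHom P.complex Y n c) (n + 1) rfl (d_comp_cocycleHom _ _ _ c) := rfl

lemma extOfCycles_surjective (Y : ModuleCat.{u} R) (n : ℕ) :
    Function.Surjective (extOfCycles P Y n) := fun x => by
  obtain ⟨f, hf, rfl⟩ := P.extMk_surjective x (n + 1) rfl
  obtain ⟨c, hc⟩ := exists_cocycleHom_eq P.complex f hf
  exact ⟨c, extMk_congr P hc (d_comp_cocycleHom _ _ _ c) hf⟩

lemma extOfCycles_eq_zero_iff (Y : ModuleCat.{u} R) (n : ℕ)
    (c : (P.complex.linearYonedaObj R Y).cycles n) :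
    extOfCycles P Y n c = 0 ↔ ((P.complex.linearYonedaObj R Y).homologyπ n).hom c = 0 := by
  cases n with
  | zero =>
    rw [homologyπ_eq_zero_iff CochainComplex.prev_nat_zero]
    refine (extMk_zero_eq_zero_iff P (cocycleHom P.complex Y 0 c)
      (d_comp_cocycleHom _ _ _ c)).trans ⟨fun h => ⟨0, ?_⟩, ?_⟩
    · rw [map_zero]
      exact h.symm
    · rintro ⟨g, hg⟩
      rw [(P.complex.linearYonedaObj R Y).shape _ _ (by simp)] at hg
      exact hg.symm
  | succ p =>
    rw [homologyπ_eq_zero_iff (CochainComplex.prev_nat_succ p)]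
    exact P.extMk_eq_zero_iff (cocycleHom P.complex Y (p + 1) c) (p + 2) rfl
      (d_comp_cocycleHom _ _ _ c) p rfl

lemma ker_homologyπ_eq_ker_extOfCycles (Y : ModuleCat.{u} R) (n : ℕ) :
    ((P.complex.linearYonedaObj R Y).homologyπ n).hom.ker = (extOfCycles P Y n).ker :=
  Submodule.ext fun c => (extOfCycles_eq_zero_iff P Y n c).symm

lemma extOfCycles_naturality (Y : ModuleCat.{u} R) (n : ℕ) {g : Z ⟶ X}
    (φ : ProjectiveResolution.Hom P' P g) (c : (P.complex.linearYonedaObj R Y).cycles n) :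
    extOfCycles P' Y n ((cyclesMap (linearYonedaMap φ.hom Y) n).hom c) =
      (Abelian.Ext.mk₀ g).comp (extOfCycles P Y n c) (zero_add n) := by
  rw [extOfCycles_apply, extOfCycles_apply, ProjectiveResolution.mk₀_comp_extMk _ _ _ _ φ]
  exact extMk_congr P' (cocycleHom_cyclesMap φ.hom Y n c) _ _

/-- The comparison of the two definitions of `Ext`. -/
noncomputable def extComparison (X Y : ModuleCat.{u} R) (n : ℕ) :
    ((Ext R (ModuleCat.{u} R) n).obj (Opposite.op X)).obj Y ≃ₗ[R] Abelian.Ext X Y n :=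
  let P := projectiveResolution X
  have hπ : Function.Surjective ((P.complex.linearYonedaObj R Y).homologyπ n).hom :=
    (ModuleCat.epi_iff_surjective _).1 inferInstance
  (P.isoExt n Y).toLinearEquiv ≪≫ₗ (LinearMap.quotKerEquivOfSurjective _ hπ).symm ≪≫ₗ
    Submodule.quotEquivOfEq _ _ (ker_homologyπ_eq_ker_extOfCycles P Y n) ≪≫ₗ
    LinearMap.quotKerEquivOfSurjective _ (extOfCycles_surjective P Y n)

lemma extComparison_eq (X Y : ModuleCat.{u} R) (n : ℕ)
    (x : ((Ext R (ModuleCat.{u} R) n).obj (Opposite.op X)).obj Y)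
    (c : ((projectiveResolution X).complex.linearYonedaObj R Y).cycles n)
    (hc : (((projectiveResolution X).complex.linearYonedaObj R Y).homologyπ n).hom c =
      ((projectiveResolution X).isoExt n Y).hom.hom x) :
    extComparison X Y n x = extOfCycles _ Y n c := by
  have hπ : Function.Surjective (((projectiveResolution X).complex.linearYonedaObj R Y).homologyπ
      n).hom := (ModuleCat.epi_iff_surjective _).1 inferInstance
  have h : (LinearMap.quotKerEquivOfSurjective _ hπ).symm
      (((projectiveResolution X).isoExt n Y).hom.hom x) = Submodule.Quotient.mk c :=
    (LinearEquiv.symm_apply_eq _).2 hc.symm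
  change LinearMap.quotKerEquivOfSurjective _ (extOfCycles_surjective _ Y n)
    (Submodule.quotEquivOfEq _ _ (ker_homologyπ_eq_ker_extOfCycles _ Y n)
      ((LinearMap.quotKerEquivOfSurjective _ hπ).symm
        (((projectiveResolution X).isoExt n Y).hom.hom x))) = _
  rw [h]
  rfl

lemma extComparison_naturality {X Z : ModuleCat.{u} R} (g : Z ⟶ X) (Y : ModuleCat.{u} R) (n : ℕ)
    (x : ((Ext R (ModuleCat.{u} R) n).obj (Opposite.op X)).obj Y) :
    extComparison Z Y n ((((Ext R (ModuleCat.{u} R) n).map g.op).app Y).hom x) =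
      (Abelian.Ext.mk₀ g).comp (extComparison X Y n x) (zero_add n) := by
  let P := projectiveResolution X
  let P' := projectiveResolution Z
  let φ : ProjectiveResolution.Hom P' P g := ⟨ProjectiveResolution.lift g P' P,
    (ProjectiveResolution.lift_commutes_zero g P' P)⟩
  have hπ : Function.Surjective ((P.complex.linearYonedaObj R Y).homologyπ n).hom :=
    (ModuleCat.epi_iff_surjective _).1 inferInstance
  obtain ⟨c, hc⟩ := hπ ((P.isoExt n Y).hom.hom x)
  rw [extComparison_eq X Y n x c hc, extComparison_eq Z Y n _
    ((cyclesMap (linearYonedaMap φ.hom Y) n).hom c), extOfCycles_naturality _ _ _ _ φ]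
  have h1 := congrArg (fun ψ => ψ.hom x) (isoExt_hom_naturality P P' n Y g φ.hom
    (ProjectiveResolution.lift_commutes_zero g P' P))
  have h2 := congrArg (fun ψ => ψ.hom c) (homologyπ_naturality (linearYonedaMap φ.hom Y) n)
  refine h2.symm.trans (Eq.trans ?_ h1.symm)
  exact congrArg (homologyMap (linearYonedaMap φ.hom Y) n).hom hc

end ExtComparison

section LocalCohomologyComparison

open Limits Opposite

variable {R : Type u} [CommRing R] (𝔞 : Ideal R)

lemma isExtLimit_of_isColimit (t : ℕ) (M : Type u) [AddCommGroup M] [Module R M]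
    (F : ℕᵒᵖᵒᵖ ⥤ ModuleCat.{u} R) (c : Cocone F) (hc : IsColimit c)
    (e : ∀ n : ℕ, F.obj (op (op n)) ≃ₗ[R] Abelian.Ext (quotPow 𝔞 n) (ModuleCat.of R M) t)
    (he : ∀ n m (h : n ≤ m) x, e m ((F.map (Quiver.Hom.op (Quiver.Hom.op (homOfLE h)))).hom x) =
      extRes h (ModuleCat.of R M) t (e n x)) :
    IsExtLimit 𝔞 t M c.pt := by
  have : PreservesFilteredColimitsOfSize.{0, 0} (forget (ModuleCat.{u} R)) :=
    preservesFilteredColimitsOfSize_shrink.{0, u, 0, u} _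
  refine ⟨fun n => (c.ι.app (op (op n))).hom.comp (e n).symm.toLinearMap, ?_, ?_, ?_⟩
  · intro n m h x
    obtain ⟨x, rfl⟩ := (e n).surjective x
    rw [← he]
    simp only [LinearMap.comp_apply, LinearEquiv.coe_coe, LinearEquiv.symm_apply_apply]
    exact congrArg (fun ψ => ψ.hom x) (c.w (Quiver.Hom.op (Quiver.Hom.op (homOfLE h))))
  · intro d
    obtain ⟨n, y, hy⟩ := Concrete.isColimit_exists_rep _ hc d
    refine ⟨n.unop.unop, e _ y, ?_⟩
    simp only [LinearMap.comp_apply, LinearEquiv.coe_coe, LinearEquiv.symm_apply_apply]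
    exact hy
  · intro n x hx
    obtain ⟨x, rfl⟩ := (e n).surjective x
    simp only [LinearMap.comp_apply, LinearEquiv.coe_coe, LinearEquiv.symm_apply_apply] at hx
    obtain ⟨k, f, g, h⟩ := Concrete.isColimit_exists_of_rep_eq F hc x
      (0 : F.obj (op (op n))) (hx.trans (map_zero _).symm)
    have hk : n ≤ k.unop.unop := leOfHom f.unop.unop
    refine ⟨k.unop.unop, hk, ?_⟩
    rw [← he]
    exact (congrArg _ (h.trans (map_zero _))).trans (map_zero _)

lemma isExtLimit_localCohomology (t : ℕ) (M : Type u) [AddCommGroup M] [Module R M] :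
    IsExtLimit 𝔞 t M ((localCohomology 𝔞 t).obj (ModuleCat.of R M)) :=
  isExtLimit_of_isColimit 𝔞 t M
    (localCohomology.diagram (localCohomology.idealPowersDiagram 𝔞) t ⋙
      (evaluation (ModuleCat.{u} R) (ModuleCat.{u} R)).obj (ModuleCat.of R M)) _
    (isColimitOfPreserves _ (colimit.isColimit _))
    (fun n => extComparison (quotPow 𝔞 n) (ModuleCat.of R M) t)
    fun _ _ h x => (extComparison_naturality (quotPowMap 𝔞 h) (ModuleCat.of R M) t x).trans
      (extRes_apply ..).symm

lemma IsExtLimit.nonempty_linearEquiv {𝔞 : Ideal R} {t : ℕ} {M D D' : Type u}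
    [AddCommGroup M] [Module R M] [AddCommGroup D] [Module R D] [AddCommGroup D'] [Module R D']
    (h : IsExtLimit 𝔞 t M D) (h' : IsExtLimit 𝔞 t M D') : Nonempty (D ≃ₗ[R] D') := by
  obtain ⟨ψ, h₁, h₂, h₃⟩ := h
  obtain ⟨ψ', h₁', h₂', h₃'⟩ := h'
  have key : ∀ n x, ψ n x = 0 ↔ ψ' n x = 0 := fun n x => by
    constructor
    · intro hx
      obtain ⟨m, hm, hx⟩ := h₃ n x hx
      rw [← h₁' n m hm, hx, map_zero]
    · intro hx
      obtain ⟨m, hm, hx⟩ := h₃' n x hx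
      rw [← h₁ n m hm, hx, map_zero]
  let Γ : Submodule R (D × D') :=
    { carrier := {p | ∃ n x, ψ n x = p.1 ∧ ψ' n x = p.2}
      zero_mem' := ⟨0, 0, map_zero _, map_zero _⟩
      add_mem' := by
        rintro _ _ ⟨n, x, hx, hx'⟩ ⟨m, y, hy, hy'⟩
        refine ⟨max n m, extRes (le_max_left _ _) _ t x + extRes (le_max_right _ _) _ t y, ?_, ?_⟩
        · rw [map_add, h₁, h₁, hx, hy]
          rfl
        · rw [map_add, h₁', h₁', hx', hy']
          rfl
      smul_mem' := by
        rintro r _ ⟨n, x, hx, hx'⟩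
        exact ⟨n, r • x, by rw [map_smul, hx]; rfl, by rw [map_smul, hx']; rfl⟩ }
  have hΓ₁ : Function.Bijective ((LinearMap.fst R D D').domRestrict Γ) := by
    refine ⟨(injective_iff_map_eq_zero _).2 ?_, fun d => ?_⟩
    · rintro ⟨⟨d, d'⟩, n, x, hx, hx'⟩ hd
      obtain rfl : d = 0 := hd
      obtain rfl : d' = 0 := hx'.symm.trans ((key n x).1 hx)
      rfl
    · obtain ⟨n, x, rfl⟩ := h₂ d
      exact ⟨⟨(_, _), n, x, rfl, rfl⟩, rfl⟩
  have hΓ₂ : Function.Bijective ((LinearMap.snd R D D').domRestrict Γ) := by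
    refine ⟨(injective_iff_map_eq_zero _).2 ?_, fun d => ?_⟩
    · rintro ⟨⟨d, d'⟩, n, x, hx, hx'⟩ hd
      obtain rfl : d' = 0 := hd
      obtain rfl : d = 0 := hx.symm.trans ((key n x).2 hx')
      rfl
    · obtain ⟨n, x, rfl⟩ := h₂' d
      exact ⟨⟨(_, _), n, x, rfl, rfl⟩, rfl⟩
  exact ⟨(LinearEquiv.ofBijective _ hΓ₁).symm ≪≫ₗ LinearEquiv.ofBijective _ hΓ₂⟩

end LocalCohomologyComparison

section Main

variable {R : Type u} [CommRing R] {𝔞 : Ideal R}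

lemma localCohomologyModule_isPowTorsion_and_extFin [IsNoetherianRing R]
    (hdim : ringKrullDim (R ⧸ 𝔞) = 1)
    (M : Type u) [AddCommGroup M] [Module R M] [Module.Finite R M] (i : ℕ) :
    IsPowTorsion 𝔞 (localCohomologyModule R 𝔞 M i) ∧
      ∀ j, ExtFin 𝔞 (localCohomologyModule R 𝔞 M i) j := by
  obtain ⟨D, _, _, hD, htors, hfin⟩ := exists_isExtLimit hdim i M fun _ => extFin_of_finite _
  obtain ⟨e⟩ := hD.nonempty_linearEquiv (isExtLimit_localCohomology 𝔞 i M)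
  exact ⟨htors.of_injective e.symm.toLinearMap e.symm.injective,
    fun j => extFin_of_linearEquiv e (hfin j)⟩

lemma IsPowTorsion.support_subset {A : Type*} [CommRing A] {𝔟 : Ideal A} {N : Type*}
    [AddCommGroup N] [Module A N] (h : IsPowTorsion 𝔟 N) :
    Module.support A N ⊆ PrimeSpectrum.zeroLocus (𝔟 : Set A) := fun p hp => by
  obtain ⟨m, hm⟩ := Module.mem_support_iff_exists_annihilator.1 hp
  obtain ⟨n, hn⟩ := h m
  refine p.2.le_of_pow_le (n := n) (le_trans (fun r hr => ?_) hm)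
  exact (Submodule.mem_annihilator_span_singleton m r).2 (hn r hr)

lemma isCofinite_iff {N : Type u} [AddCommGroup N] [Module R N] :
    IsCofinite R 𝔞 N ↔ Module.support R N ⊆ PrimeSpectrum.zeroLocus (𝔞 : Set R) ∧
      ∀ i, ExtFin 𝔞 N i :=
  and_congr_right fun _ => forall_congr' fun i => Module.Finite.equiv_iff
    (extComparison (ModuleCat.of R (R ⧸ 𝔞)) (ModuleCat.of R N) i)

lemma isMaximal_of_mem_support_of_isArtinian {A : Type*} [CommRing A] {N : Type*}
    [AddCommGroup N] [Module A N] [IsArtinian A N] {p : PrimeSpectrum A}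
    (hp : p ∈ Module.support A N) : p.asIdeal.IsMaximal := by
  obtain ⟨m, hm⟩ := Module.mem_support_iff_exists_annihilator.1 hp
  have h1 : IsArtinian A (A ⧸ LinearMap.ker (LinearMap.toSpanSingleton A N m)) :=
    isArtinian_of_linearEquiv (LinearMap.quotKerEquivRange _).symm
  have hle : LinearMap.ker (LinearMap.toSpanSingleton A N m) ≤ p.asIdeal := fun r hr =>
    hm ((Submodule.mem_annihilator_span_singleton m r).2 hr)
  have h2 : IsArtinian A (A ⧸ p.asIdeal) :=
    isArtinian_of_surjective _ (Submodule.factor hle) (Submodule.factor_surjective hle)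
  have h3 : IsArtinianRing (A ⧸ p.asIdeal) := isArtinian_of_tower A h2
  exact Ideal.Quotient.maximal_of_isField _ (IsArtinianRing.isField_of_isDomain _)

lemma IsPowTorsion.isArtinian_of_support_subset [IsNoetherianRing R] {N : Type u}
    [AddCommGroup N] [Module R N]
    (h : IsPowTorsion 𝔞 N) (h0 : ExtFin 𝔞 N 0)
    (hsupp : ∀ p ∈ Module.support R N, p.asIdeal.IsMaximal) : IsArtinian R N := by
  have hfin := extFin_zero_iff.1 h0
  refine h.isArtinian ((isNoetherian_iff_isArtinian_of_forall_smul_eq_zero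
    (c := Module.annihilator R (Submodule.torsionBySet R N (𝔞 : Set R))) (fun p hp hle => ?_)
    fun r hr => Module.mem_annihilator.1 hr).1
      (isNoetherian_of_isNoetherianRing_of_finite R _))
  exact hsupp ⟨p, hp⟩ (Module.support_subset_of_injective
    (Submodule.torsionBySet R N (𝔞 : Set R)).subtype (Submodule.subtype_injective _)
    (Module.mem_support_iff_of_finite.2 hle))

end Main

/-- Theorem 4.2: if `dim R/𝔞 = 1` and `M` is a finitely generated `R`-module, the following
are equivalent for an integer `r`: (i) `Supp H^i_𝔞(M)` consists of maximal ideals for `i > r`;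
(ii) `H^i_𝔞(M)` is Artinian for `i > r`; (iii) `H^i_𝔞(M)` is Artinian and `𝔞`-cofinite for
`i > r`. -/
theorem tfae_artinian_localCohomology_of_dim_quot_eq_one
    (R : Type u) [CommRing R] [IsNoetherianRing R] (𝔞 : Ideal R)
    (hdim : ringKrullDim (R ⧸ 𝔞) = 1)
    (M : Type u) [AddCommGroup M] [Module R M] [Module.Finite R M] (r : ℤ) :
    List.TFAE
      [ ∀ i : ℕ, r < (i : ℤ) →
          Module.support R (localCohomologyModule R 𝔞 M i) ⊆
            { 𝔭 : PrimeSpectrum R | 𝔭.asIdeal.IsMaximal },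
        ∀ i : ℕ, r < (i : ℤ) → IsArtinian R (localCohomologyModule R 𝔞 M i),
        ∀ i : ℕ, r < (i : ℤ) → IsArtinian R (localCohomologyModule R 𝔞 M i) ∧
          IsCofinite R 𝔞 (localCohomologyModule R 𝔞 M i) ] := by
  tfae_have 1 → 3 := fun h i hi => by
    obtain ⟨htors, hfin⟩ := localCohomologyModule_isPowTorsion_and_extFin hdim M i
    exact ⟨htors.isArtinian_of_support_subset (hfin 0) fun p hp => h i hi hp,
      isCofinite_iff.2 ⟨htors.support_subset, hfin⟩⟩
  tfae_have 3 → 2 := fun h i hi => (h i hi).1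
  tfae_have 2 → 1 := fun h i hi p hp => by
    have := h i hi
    exact isMaximal_of_mem_support_of_isArtinian hp
  tfae_finish
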